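/- arXiv:1610.09703 — 6 statements merged into one kernel-verified Lean document; each statement's English description precedes it below -/
import Mathlib

section
/- Consider the affine control system ẋ = Ax + Bu + a on ℝⁿ and n-dimensional polytopes X, X' such that X ⊂ X', X° ∩ 𝒪 = ∅, and X'° ∩ 𝒪 ≠ ∅, where 𝒪 := {x ∈ ℝⁿ : Ax + a ∈ Im(B)}. Suppose (i) (A,B) is controllable; (ii) there exists an n-dimensional polytope X₁ with X ⊂ X₁ ⊆ X' such that for each x ∈ ∂X₁ there exists u ∈ ℝ^m with Ax + Bu + a in the interior of the tangent cone to X₁ at x; (iii) there exists an n-dimensional polytope X₂ with X ⊂ X₂ ⊆ X' such that for each x ∈ ∂X₂ there exists u ∈ ℝ^m with −Ax − Bu − a in the interior of the tangent cone to X₂ at x; and (iv) X₁° ∩ X₂° ∩ 𝒪 ≠ ∅. Then the system is relaxed in-block controllable (RIBC) with respect to X through X'. -/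
open Matrix Set Pointwise MeasureTheory

/-- Carathéodory (integral) solution of `ẋ = A x + B u + a` on `[0, T]`. -/
def IsSol {n m : ℕ} (A : Matrix (Fin n) (Fin n) ℝ) (B : Matrix (Fin n) (Fin m) ℝ)
    (a : Fin n → ℝ) (u : ℝ → Fin m → ℝ) (φ : ℝ → Fin n → ℝ) (T : ℝ) : Prop :=
  ∀ t ∈ Set.Icc (0 : ℝ) T,
    φ t = φ 0 + ∫ s in (0 : ℝ)..t, (A.mulVec (φ s) + B.mulVec (u s) + a)

/-- Controllability matrix `[B AB ⋯ A^{n-1}B]`. -/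
def ctrbMat {n m : ℕ} (A : Matrix (Fin n) (Fin n) ℝ) (B : Matrix (Fin n) (Fin m) ℝ) :
    Matrix (Fin n) (Fin n × Fin m) ℝ :=
  Matrix.of fun i p => ((A ^ (p.1 : ℕ)) * B) i p.2

/-- Kalman controllability of the pair `(A, B)`: the controllability matrix has rank `n`. -/
def Controllable {n m : ℕ} (A : Matrix (Fin n) (Fin n) ℝ)
    (B : Matrix (Fin n) (Fin m) ℝ) : Prop :=
  (ctrbMat A B).rank = n

/-- An `n`-dimensional polytope: convex hull of finitely many points, with nonempty interior. -/
def IsNPolytope {n : ℕ} (X : Set (Fin n → ℝ)) : Prop :=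
  (∃ V : Finset (Fin n → ℝ), X = convexHull ℝ (V : Set (Fin n → ℝ))) ∧ (interior X).Nonempty

/-- The set `𝒪` of possible equilibria of `ẋ = A x + B u + a`:
points `x` with `A x + a ∈ Im B`. -/
def equilSet {n m : ℕ} (A : Matrix (Fin n) (Fin n) ℝ) (B : Matrix (Fin n) (Fin m) ℝ)
    (a : Fin n → ℝ) : Set (Fin n → ℝ) :=
  {x | ∃ u : Fin m → ℝ, A.mulVec x + a = B.mulVec u}

/-- The Bouligand tangent cone to a set `S` at `x`. -/
def bouligand {n : ℕ} (S : Set (Fin n → ℝ)) (x : Fin n → ℝ) : Set (Fin n → ℝ) :=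
  {v | Filter.liminf (fun t : ℝ => Metric.infDist (x + t • v) S / t)
        (nhdsWithin 0 (Set.Ioi 0)) = 0}

/-- Relaxed in-block controllability of `ẋ = Ax + Bu + a` w.r.t. `X` through `X'`:
all states of `X°` are mutually accessible through `X'°` with uniformly bounded controls. -/
def RIBC {n m : ℕ} (A : Matrix (Fin n) (Fin n) ℝ) (B : Matrix (Fin n) (Fin m) ℝ)
    (a : Fin n → ℝ) (X X' : Set (Fin n → ℝ)) : Prop :=
  ∃ M > (0 : ℝ), ∀ x ∈ interior X, ∀ y ∈ interior X,
    ∃ T ≥ (0 : ℝ), ∃ u : ℝ → Fin m → ℝ, ∃ φ : ℝ → Fin n → ℝ,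
      Measurable u ∧ IsSol A B a u φ T ∧ φ 0 = x ∧ φ T = y ∧
      (∀ t ∈ Set.Icc (0 : ℝ) T, ‖u t‖ ≤ M) ∧
      (∀ t ∈ Set.Icc (0 : ℝ) T, φ t ∈ interior X')

/-- `x` can be steered to `y` in time `T` for `ẋ = A x + B u`, with controls bounded by `M`,
inside `S`. -/
def Steer {n m : ℕ} (A : Matrix (Fin n) (Fin n) ℝ) (B : Matrix (Fin n) (Fin m) ℝ)
    (M : ℝ) (S : Set (Fin n → ℝ)) (T : ℝ) (x y : Fin n → ℝ) : Prop :=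
  0 ≤ T ∧ ∃ (u : ℝ → Fin m → ℝ) (φ : ℝ → Fin n → ℝ), Measurable u ∧
    IntervalIntegrable (fun s => A.mulVec (φ s) + B.mulVec (u s)) volume 0 T ∧
    (∀ t ∈ Set.Icc (0 : ℝ) T, φ t = x + ∫ s in (0 : ℝ)..t, (A.mulVec (φ s) + B.mulVec (u s))) ∧
    φ T = y ∧ (∀ t ∈ Set.Icc (0 : ℝ) T, ‖u t‖ ≤ M) ∧ (∀ t ∈ Set.Icc (0 : ℝ) T, φ t ∈ S)

section steer

variable {n m : ℕ} {A : Matrix (Fin n) (Fin n) ℝ} {B : Matrix (Fin n) (Fin m) ℝ}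

lemma Steer.mono {M M' : ℝ} {S S' : Set (Fin n → ℝ)} {T : ℝ} {x y : Fin n → ℝ}
    (h : Steer A B M S T x y) (hM : M ≤ M') (hS : S ⊆ S') : Steer A B M' S' T x y := by
  obtain ⟨hT, u, φ, h1, h2, h3, h4, h5, h6⟩ := h
  exact ⟨hT, u, φ, h1, h2, h3, h4, fun t ht => (h5 t ht).trans hM, fun t ht => hS (h6 t ht)⟩

lemma Steer.refl {M : ℝ} {S : Set (Fin n → ℝ)} {x : Fin n → ℝ} (hM : 0 ≤ M) (hx : x ∈ S) :
    Steer A B M S 0 x x := by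
  refine ⟨le_rfl, fun _ => 0, fun _ => x, measurable_const, ?_, ?_, rfl, ?_, ?_⟩
  · simp
  · intro t ht
    have : t = 0 := le_antisymm ht.2 ht.1
    simp [this]
  · intro t _; simpa using hM
  · intro t _; exact hx

lemma Steer.zero {M : ℝ} {S : Set (Fin n → ℝ)} {T : ℝ} (hT : 0 ≤ T) (hM : 0 ≤ M)
    (hx : (0 : Fin n → ℝ) ∈ S) : Steer A B M S T 0 0 := by
  refine ⟨hT, fun _ => 0, fun _ => 0, measurable_const, ?_, ?_, rfl, ?_, ?_⟩
  · simp
  · intro t ht; simp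
  · intro t _; simpa using hM
  · intro t _; exact hx

lemma Steer.trans {M : ℝ} {S : Set (Fin n → ℝ)} {T₁ T₂ : ℝ} {x y z : Fin n → ℝ}
    (h : Steer A B M S T₁ x y) (h' : Steer A B M S T₂ y z) : Steer A B M S (T₁ + T₂) x z := by
  obtain ⟨hT, u, φ, h1, h2, h3, h4, h5, h6⟩ := h
  obtain ⟨hT', u', φ', h1', h2', h3', h4', h5', h6'⟩ := h'
  set U : ℝ → Fin m → ℝ := fun t => if t < T₁ then u t else u' (t - T₁) with hU
  set Φ : ℝ → Fin n → ℝ := fun t => if t < T₁ then φ t else φ' (t - T₁) with hΦ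
  set f := fun s => A.mulVec (φ s) + B.mulVec (u s) with hf
  set f' := fun s => A.mulVec (φ' s) + B.mulVec (u' s) with hf'
  set F := fun s => A.mulVec (Φ s) + B.mulVec (U s) with hF
  have y0 : φ' 0 = y := by simpa using h3' 0 ⟨le_rfl, hT'⟩
  have e1 : ∀ t, t < T₁ → F t = f t := by
    intro t ht; simp [hF, hΦ, hU, hf, ht]
  have e2 : ∀ t, T₁ ≤ t → F t = f' (t - T₁) := by
    intro t ht; simp [hF, hΦ, hU, hf', not_lt.2 ht]
  have i1 : ∀ t, t ∈ Icc 0 T₁ → ∫ s in (0 : ℝ)..t, F s = ∫ s in (0 : ℝ)..t, f s := by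
    intro t ht
    apply intervalIntegral.integral_congr_ae
    have : ∀ᵐ s : ℝ, s ≠ T₁ := by
      simp [ae_iff]
    filter_upwards [this] with s hs hs2
    rw [uIoc_of_le ht.1] at hs2
    exact e1 s (lt_of_le_of_ne (hs2.2.trans ht.2) hs)
  have i2 : ∀ t, T₁ ≤ t → ∫ s in T₁..t, F s = ∫ s in (0 : ℝ)..(t - T₁), f' s := by
    intro t ht
    have : ∫ s in T₁..t, F s = ∫ s in T₁..t, f' (s - T₁) := by
      apply intervalIntegral.integral_congr
      intro s hs
      rw [uIcc_of_le ht] at hs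
      exact e2 s hs.1
    rw [this, intervalIntegral.integral_comp_sub_right]
    simp
  have I1 : IntervalIntegrable F volume 0 T₁ := by
    refine h2.congr_ae ?_
    rw [Filter.EventuallyEq, ae_restrict_iff' measurableSet_uIoc]
    have : ∀ᵐ s : ℝ, s ≠ T₁ := by
      simp [ae_iff]
    filter_upwards [this] with s hs hs2
    rw [uIoc_of_le hT] at hs2
    exact (e1 s (lt_of_le_of_ne hs2.2 hs)).symm
  have I2 : IntervalIntegrable F volume T₁ (T₁ + T₂) := by
    have := h2'.comp_sub_right T₁
    rw [zero_add, add_comm T₂] at this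
    refine this.congr ?_
    intro s hs
    rw [uIoc_of_le (by linarith)] at hs
    exact (e2 s hs.1.le).symm
  have y1 : x + ∫ s in (0 : ℝ)..T₁, f s = y := by
    rw [← h3 T₁ ⟨hT, le_rfl⟩, h4]
  refine ⟨by linarith, U, Φ, ?_, I1.trans I2, ?_, ?_, ?_, ?_⟩
  · exact Measurable.ite measurableSet_Iio h1 (h1'.comp (measurable_id.sub_const _))
  · intro t ht
    by_cases htt : t < T₁
    · have : Φ t = φ t := by simp [hΦ, htt]
      rw [this, h3 t ⟨ht.1, htt.le⟩, i1 t ⟨ht.1, htt.le⟩]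
    · have e : Φ t = φ' (t - T₁) := by simp [hΦ, htt]
      push Not at htt
      rw [e, h3' (t - T₁) ⟨by linarith, by linarith [ht.2]⟩, ← i2 t htt, ← y1,
        ← i1 T₁ ⟨hT, le_rfl⟩, add_assoc, intervalIntegral.integral_add_adjacent_intervals I1]
      refine I2.mono_set ?_
      rw [uIcc_of_le htt, uIcc_of_le (by linarith)]
      exact Icc_subset_Icc_right ht.2
  · have : ¬ (T₁ + T₂ < T₁) := by linarith
    simp [hΦ, this, h4']
  · intro t ht
    by_cases htt : t < T₁
    · simpa [hU, htt] using h5 t ⟨ht.1, htt.le⟩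
    · simpa [hU, htt] using h5' (t - T₁) ⟨by linarith, by linarith [ht.2]⟩
  · intro t ht
    by_cases htt : t < T₁
    · simpa [hΦ, htt] using h6 t ⟨ht.1, htt.le⟩
    · simpa [hΦ, htt] using h6' (t - T₁) ⟨by linarith, by linarith [ht.2]⟩

lemma Steer.smul {M : ℝ} {S S' : Set (Fin n → ℝ)} {T : ℝ} {x y : Fin n → ℝ} (c : ℝ)
    (h : Steer A B M S T x y) (hS : ∀ z ∈ S, c • z ∈ S') :
    Steer A B (|c| * M) S' T (c • x) (c • y) := by
  obtain ⟨hT, u, φ, h1, h2, h3, h4, h5, h6⟩ := h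
  have e : (fun s => A.mulVec (c • φ s) + B.mulVec (c • u s)) =
      fun s => c • (A.mulVec (φ s) + B.mulVec (u s)) := by
    funext s; simp [Matrix.mulVec_smul]
  refine ⟨hT, fun t => c • u t, fun t => c • φ t, h1.const_smul c, ?_, ?_, by simp [h4], ?_, ?_⟩
  · rw [e]; exact h2.smul c
  · intro t ht
    rw [e, intervalIntegral.integral_smul, ← smul_add, ← h3 t ht]
  · intro t ht
    rw [norm_smul, Real.norm_eq_abs]
    exact mul_le_mul_of_nonneg_left (h5 t ht) (abs_nonneg _)
  · intro t ht; exact hS _ (h6 t ht)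

lemma Steer.add {M M' : ℝ} {S S' S'' : Set (Fin n → ℝ)} {T : ℝ} {x y x' y' : Fin n → ℝ}
    (h : Steer A B M S T x y) (h' : Steer A B M' S' T x' y')
    (hS : ∀ z ∈ S, ∀ z' ∈ S', z + z' ∈ S'') :
    Steer A B (M + M') S'' T (x + x') (y + y') := by
  obtain ⟨hT, u, φ, h1, h2, h3, h4, h5, h6⟩ := h
  obtain ⟨hT', u', φ', h1', h2', h3', h4', h5', h6'⟩ := h'
  have e : (fun s => A.mulVec (φ s + φ' s) + B.mulVec (u s + u' s)) =
      fun s => (A.mulVec (φ s) + B.mulVec (u s)) + (A.mulVec (φ' s) + B.mulVec (u' s)) := by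
    funext s; rw [Matrix.mulVec_add, Matrix.mulVec_add]; abel
  refine ⟨hT, fun t => u t + u' t, fun t => φ t + φ' t, h1.add h1', ?_, ?_, by simp [h4, h4'],
    ?_, ?_⟩
  · rw [e]; exact h2.add h2'
  · intro t ht
    have hs : uIcc 0 t ⊆ uIcc 0 T := by
      rw [uIcc_of_le ht.1, uIcc_of_le hT]; exact Icc_subset_Icc_right ht.2
    rw [e, intervalIntegral.integral_add (h2.mono_set hs) (h2'.mono_set hs)]
    change φ t + φ' t = _
    rw [h3 t ht, h3' t ht]; abel
  · intro t ht
    exact (norm_add_le _ _).trans (add_le_add (h5 t ht) (h5' t ht))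
  · intro t ht; exact hS _ (h6 t ht) _ (h6' t ht)

lemma Steer.reverse {M : ℝ} {S : Set (Fin n → ℝ)} {T : ℝ} {x y : Fin n → ℝ}
    (h : Steer (-A) (-B) M S T x y) : Steer A B M S T y x := by
  obtain ⟨hT, u, φ, h1, h2, h3, h4, h5, h6⟩ := h
  set f := fun s => A.mulVec (φ s) + B.mulVec (u s) with hf
  have e : (fun s => (-A).mulVec (φ s) + (-B).mulVec (u s)) = fun s => - f s := by
    funext s; simp only [hf, Matrix.neg_mulVec]; abel
  rw [e] at h2 h3
  have h2' : IntervalIntegrable f volume 0 T := by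
    have := h2.neg
    rwa [show (-fun s => -f s) = f by funext s; simp] at this
  have x0 : φ 0 = x := by simpa using h3 0 ⟨le_rfl, hT⟩
  refine ⟨hT, fun t => u (T - t), fun t => φ (T - t), h1.comp (measurable_const.sub measurable_id),
    ?_, ?_, by simp [x0], ?_, ?_⟩
  · have := h2'.comp_sub_left T
    simpa using this.symm
  · intro t ht
    have : ∫ s in (0:ℝ)..t, f (T - s) = ∫ s in (T - t)..T, f s := by
      rw [intervalIntegral.integral_comp_sub_left]; simp
    change φ (T - t) = y + ∫ s in (0:ℝ)..t, f (T - s)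
    have m1 : T - t ∈ Icc 0 T := ⟨by linarith [ht.2], by linarith [ht.1]⟩
    rw [this, ← h4, h3 T ⟨hT, le_rfl⟩, h3 _ m1]
    rw [intervalIntegral.integral_neg, intervalIntegral.integral_neg]
    have ha : IntervalIntegrable f volume 0 (T - t) := h2'.mono_set (by
      rw [uIcc_of_le m1.1, uIcc_of_le hT]; exact Icc_subset_Icc_right m1.2)
    have hb : IntervalIntegrable f volume (T - t) T := h2'.mono_set (by
      rw [uIcc_of_le m1.2, uIcc_of_le hT]; exact Icc_subset_Icc_left m1.1)
    rw [← intervalIntegral.integral_add_adjacent_intervals ha hb]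
    abel
  · intro t ht; exact h5 _ ⟨by linarith [ht.2], by linarith [ht.1]⟩
  · intro t ht; exact h6 _ ⟨by linarith [ht.2], by linarith [ht.1]⟩

lemma continuous_mulVec' {k l : ℕ} (C : Matrix (Fin k) (Fin l) ℝ) :
    Continuous fun x : Fin l → ℝ => C.mulVec x :=
  (Matrix.mulVecLin C).continuous_of_finiteDimensional

/-- Integral formula for a constant-control curve. -/
lemma curve_integral {u : Fin m → ℝ} {γ : ℝ → Fin n → ℝ}
    (hγ : ∀ t, HasDerivAt γ (A.mulVec (γ t) + B.mulVec u) t) (t : ℝ) :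
    Continuous (fun s => A.mulVec (γ s) + B.mulVec u) ∧
    γ t = γ 0 + ∫ s in (0 : ℝ)..t, (A.mulVec (γ s) + B.mulVec u) := by
  have hc : Continuous γ := continuous_iff_continuousAt.2 fun t => (hγ t).continuousAt
  have hc' : Continuous (fun s => A.mulVec (γ s) + B.mulVec u) :=
    ((continuous_mulVec' A).comp hc).add continuous_const
  refine ⟨hc', ?_⟩
  rw [intervalIntegral.integral_eq_sub_of_hasDerivAt (fun s _ => hγ s)
    (hc'.intervalIntegrable _ _)]
  abel

lemma Steer.of_curve {u : Fin m → ℝ} {γ : ℝ → Fin n → ℝ} {S : Set (Fin n → ℝ)} {T : ℝ}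
    (hT : 0 ≤ T)
    (hγ : ∀ t, HasDerivAt γ (A.mulVec (γ t) + B.mulVec u) t)
    (hS : ∀ t ∈ Icc 0 T, γ t ∈ S) : Steer A B ‖u‖ S T (γ 0) (γ T) :=
  ⟨hT, fun _ => u, γ, measurable_const, (curve_integral hγ 0).1.intervalIntegrable _ _,
    fun t _ => (curve_integral hγ t).2, rfl, fun _ _ => le_rfl, hS⟩

/-- The flow under a constant control. -/
lemma exists_flow (A : Matrix (Fin n) (Fin n) ℝ) (B : Matrix (Fin n) (Fin m) ℝ) (u : Fin m → ℝ) :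
    ∃ ψ : ℝ → (Fin n → ℝ) → (Fin n → ℝ), Continuous (fun p : ℝ × (Fin n → ℝ) => ψ p.1 p.2) ∧
      (∀ x, ψ 0 x = x) ∧
      ∀ x t, HasDerivAt (fun s => ψ s x) (A.mulVec (ψ t x) + B.mulVec u) t := by
  let L₀ : ((Fin n → ℝ) × ℝ) →ₗ[ℝ] ((Fin n → ℝ) × ℝ) :=
    LinearMap.prod ((Matrix.mulVecLin A).comp (LinearMap.fst ℝ _ _) +
      (LinearMap.snd ℝ (Fin n → ℝ) ℝ).smulRight (B.mulVec u)) 0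
  let L : ((Fin n → ℝ) × ℝ) →L[ℝ] ((Fin n → ℝ) × ℝ) := LinearMap.toContinuousLinearMap L₀
  have hL : ∀ p : (Fin n → ℝ) × ℝ, L p = (A.mulVec p.1 + p.2 • B.mulVec u, 0) := by
    intro p; simp [L, L₀]
  let g : ℝ → (Fin n → ℝ) → (Fin n → ℝ) × ℝ := fun t x => NormedSpace.exp (t • L) (x, 1)
  have hg : ∀ x t, HasDerivAt (fun s => g s x) (L (g t x)) t := by
    intro x t
    have := (hasDerivAt_exp_smul_const' (𝕂 := ℝ) L t)
    have h2 := this.clm_apply (hasDerivAt_const t ((x, 1) : (Fin n → ℝ) × ℝ))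
    simpa [g] using h2
  have hg0 : ∀ x, g 0 x = (x, 1) := by intro x; simp [g]
  have hg2 : ∀ x t, (g t x).2 = 1 := by
    intro x t
    have hd : ∀ t, HasDerivAt (fun s => (g s x).2) 0 t := by
      intro t
      have := (hg x t).snd
      rwa [hL] at this
    have := is_const_of_deriv_eq_zero (fun t => (hd t).differentiableAt)
      (fun t => (hd t).deriv) t 0
    rw [this, hg0]
  refine ⟨fun t x => (g t x).1, ?_, ?_, ?_⟩
  · refine continuous_fst.comp ?_
    have h1 : Continuous fun t : ℝ => NormedSpace.exp (t • L) :=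
      continuous_iff_continuousAt.2 fun t =>
        (hasDerivAt_exp_smul_const' (𝕂 := ℝ) L t).continuousAt
    exact (h1.comp continuous_fst).clm_apply (by fun_prop)
  · intro x; simp [hg0]
  · intro x t
    have := (hg x t).fst
    rw [hL] at this
    rw [hg2, one_smul] at this
    exact this

end steer

section main

variable {n m : ℕ} {A : Matrix (Fin n) (Fin n) ℝ} {B : Matrix (Fin n) (Fin m) ℝ}

/-- Invariant-subspace form of controllability. -/
def GenCtrb (A : Matrix (Fin n) (Fin n) ℝ) (B : Matrix (Fin n) (Fin m) ℝ) : Prop :=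
  ∀ R : Submodule ℝ (Fin n → ℝ), (∀ u, B.mulVec u ∈ R) → (∀ x ∈ R, A.mulVec x ∈ R) → R = ⊤

lemma GenCtrb.neg (h : GenCtrb A B) : GenCtrb (-A) (-B) := by
  intro R h1 h2
  apply h R
  · intro u
    simpa [Matrix.neg_mulVec] using h1 u
  · intro x hx
    simpa [Matrix.neg_mulVec] using h2 x hx

lemma genCtrb_of_controllable (h : Controllable A B) : GenCtrb A B := by
  intro R h1 h2
  have hk : ∀ k : ℕ, ∀ u, (A ^ k).mulVec (B.mulVec u) ∈ R := by
    intro k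
    induction k with
    | zero => intro u; simpa using h1 u
    | succ k ih =>
      intro u
      rw [pow_succ', ← Matrix.mulVec_mulVec]
      exact h2 _ (ih u)
  have hr : LinearMap.range (ctrbMat A B).mulVecLin = ⊤ := by
    apply Submodule.eq_top_of_finrank_eq
    have : (ctrbMat A B).rank = n := h
    rw [Matrix.rank] at this
    rw [this]; simp
  rw [eq_top_iff, ← hr]
  rintro _ ⟨w, rfl⟩
  rw [Matrix.mulVecLin_apply, Matrix.mulVec_eq_sum]
  refine Submodule.sum_mem _ fun p _ => ?_
  rw [op_smul_eq_smul]
  refine Submodule.smul_mem _ _ ?_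
  have := hk p.1 (Pi.single p.2 1)
  rw [Matrix.mulVec_mulVec, Matrix.mulVec_single_one] at this
  exact this

lemma Steer.nonneg {M : ℝ} {S : Set (Fin n → ℝ)} {T : ℝ} {x y : Fin n → ℝ}
    (h : Steer A B M S T x y) : 0 ≤ M := by
  obtain ⟨hT, u, φ, h1, h2, h3, h4, h5, h6⟩ := h
  exact (norm_nonneg _).trans (h5 0 ⟨le_rfl, hT⟩)

/-- Null-controllability with an explicit bound. -/
def NC (A : Matrix (Fin n) (Fin n) ℝ) (B : Matrix (Fin n) (Fin m) ℝ) (K : ℝ)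
    (x : Fin n → ℝ) : Prop :=
  ∃ T, Steer A B K (Metric.closedBall 0 K) T x 0

lemma NC.zero {K : ℝ} (hK : 0 ≤ K) : NC A B K 0 :=
  ⟨0, Steer.zero le_rfl hK (by simpa using hK)⟩

lemma NC.smul {K : ℝ} {x : Fin n → ℝ} (h : NC A B K x) (c : ℝ) : NC A B (|c| * K) (c • x) := by
  obtain ⟨T, h⟩ := h
  refine ⟨T, ?_⟩
  have := Steer.smul (S' := Metric.closedBall 0 (|c| * K)) c h (by
    intro z hz
    rw [mem_closedBall_zero_iff] at hz ⊢
    rw [norm_smul, Real.norm_eq_abs]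
    exact mul_le_mul_of_nonneg_left hz (abs_nonneg _))
  simpa using this

lemma Steer.pad {K T T' : ℝ} {x : Fin n → ℝ}
    (h : Steer A B K (Metric.closedBall 0 K) T x 0) (hT : T ≤ T') :
    Steer A B K (Metric.closedBall 0 K) T' x 0 := by
  have := h.trans (Steer.zero (T := T' - T) (by linarith) h.nonneg (by simpa using h.nonneg))
  simpa using this

lemma NC.add {K L : ℝ} {x y : Fin n → ℝ} (h : NC A B K x) (h' : NC A B L y) :
    NC A B (K + L) (x + y) := by
  obtain ⟨T, h⟩ := h
  obtain ⟨T', h'⟩ := h'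
  refine ⟨max T T', ?_⟩
  have := Steer.add (S'' := Metric.closedBall 0 (K + L)) (h.pad (le_max_left T T'))
    (h'.pad (le_max_right T T')) (by
    intro z hz z' hz'
    rw [mem_closedBall_zero_iff] at hz hz' ⊢
    exact (norm_add_le _ _).trans (add_le_add hz hz'))
  simpa using this

lemma NC.mono {K L : ℝ} {x : Fin n → ℝ} (h : NC A B K x) (hKL : K ≤ L) : NC A B L x := by
  obtain ⟨T, h⟩ := h
  exact ⟨T, h.mono hKL (Metric.closedBall_subset_closedBall hKL)⟩

lemma nc_all (h : GenCtrb A B) (x : Fin n → ℝ) : ∃ K, NC A B K x := by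
  let R : Submodule ℝ (Fin n → ℝ) :=
    { carrier := {x | ∃ K, NC A B K x}
      add_mem' := by
        rintro x y ⟨K, hK⟩ ⟨L, hL⟩
        exact ⟨_, hK.add hL⟩
      zero_mem' := ⟨0, NC.zero le_rfl⟩
      smul_mem' := by
        rintro c x ⟨K, hK⟩
        exact ⟨_, hK.smul c⟩ }
  have key : ∀ x ∈ R, ∀ u, A.mulVec x + B.mulVec u ∈ R := by
    rintro x ⟨K, T, hK⟩ u
    obtain ⟨ψ, hψc, hψ0, hψ⟩ := exists_flow A B u
    have hcont : Continuous fun t => ψ t x := hψc.comp (by fun_prop : Continuous fun t : ℝ => (t, x))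
    have hmem : ∀ s : ℝ, s < 0 → ψ s x ∈ R := by
      intro s hs
      have hd : ∀ t, HasDerivAt (fun t => ψ (t + s) x)
          (A.mulVec (ψ (t + s) x) + B.mulVec u) t := by
        intro t
        exact (hψ x (t + s)).comp_add_const t s
      obtain ⟨C, hC⟩ := (isCompact_Icc (a := (0:ℝ)) (b := -s)).exists_bound_of_continuousOn
        (f := fun t => ψ (t + s) x) (hcont.comp (continuous_add_const s)).continuousOn
      have := Steer.of_curve (S := Metric.closedBall 0 C) (T := -s) (by linarith) hd
        (by intro t ht; rw [mem_closedBall_zero_iff]; exact hC t ht)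
      simp only [zero_add, neg_add_cancel, hψ0] at this
      let D := max K (max ‖u‖ C)
      have a1 : Steer A B D (Metric.closedBall 0 D) (-s) (ψ s x) x :=
        this.mono ((le_max_left _ _).trans (le_max_right _ _))
          (Metric.closedBall_subset_closedBall ((le_max_right _ _).trans (le_max_right _ _)))
      have a2 : Steer A B D (Metric.closedBall 0 D) T x 0 :=
        hK.mono (le_max_left _ _) (Metric.closedBall_subset_closedBall (le_max_left _ _))
      exact ⟨D, _, a1.trans a2⟩
    have hx : x ∈ R := ⟨K, T, hK⟩
    have hsl := ((hψ x 0).hasDerivWithinAt (s := Iio 0))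
    rw [hasDerivWithinAt_iff_tendsto_slope' (by simp)] at hsl
    rw [hψ0] at hsl
    have hcl : IsClosed (R : Set (Fin n → ℝ)) := R.closed_of_finiteDimensional
    refine hcl.mem_of_tendsto hsl ?_
    filter_upwards [self_mem_nhdsWithin] with s hs
    rw [slope_def_module]
    refine R.smul_mem _ (R.sub_mem (hmem s hs) ?_)
    rw [hψ0]; exact hx
  have hB : ∀ u, B.mulVec u ∈ R := by
    intro u
    simpa using key 0 R.zero_mem u
  have hA : ∀ x ∈ R, A.mulVec x ∈ R := by
    intro x hx
    simpa using key x hx 0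
  have := h R hB hA
  have hx : x ∈ R := by rw [this]; trivial
  exact hx

lemma nc_local (h : GenCtrb A B) : ∃ C > 0, ∀ x : Fin n → ℝ, NC A B (C * ‖x‖) x := by
  choose K hK using fun i : Fin n => nc_all h (Pi.single i 1)
  have hK0 : ∀ i, 0 ≤ K i := fun i => (hK i).choose_spec.nonneg
  refine ⟨∑ i, K i + 1, by have := Finset.sum_nonneg (fun i (_ : i ∈ Finset.univ) => hK0 i); linarith,
    fun x => ?_⟩
  have hs : ∀ s : Finset (Fin n), NC A B (∑ i ∈ s, |x i| * K i)
      (∑ i ∈ s, x i • (Pi.single i 1 : Fin n → ℝ)) := by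
    intro s
    induction s using Finset.induction_on with
    | empty => simpa using NC.zero le_rfl
    | insert i s hi ih =>
      rw [Finset.sum_insert hi, Finset.sum_insert hi]
      exact ((hK i).smul (x i)).add ih
  have hx : ∑ i, x i • (Pi.single i 1 : Fin n → ℝ) = x := by
    funext j
    simp [Finset.sum_apply, Pi.single_apply]
  have := hs Finset.univ
  rw [hx] at this
  refine this.mono ?_
  rw [add_mul, one_mul, Finset.sum_mul]
  have : ∑ i, |x i| * K i ≤ ∑ i, K i * ‖x‖ := by
    refine Finset.sum_le_sum fun i _ => ?_
    rw [mul_comm]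
    exact mul_le_mul_of_nonneg_left (norm_le_pi_norm x i) (hK0 i)
  linarith [norm_nonneg x]

lemma bouligand_interior {P : Set (Fin n → ℝ)} (hP : Convex ℝ P) {x v p₀ : Fin n → ℝ}
    (hx : x ∈ P) (hp : p₀ ∈ interior P) (hv : v ∈ interior (bouligand P x)) :
    ∃ t > (0 : ℝ), x + t • v ∈ interior P := by
  obtain ⟨r, hr, hball⟩ := Metric.isOpen_iff.1 isOpen_interior p₀ hp
  have hcont : Filter.Tendsto (fun s : ℝ => v - s • (p₀ - x)) (nhdsWithin 0 (Ioi 0)) (nhds v) := by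
    have : Continuous (fun s : ℝ => v - s • (p₀ - x)) := by fun_prop
    have h := this.tendsto 0
    simp only [zero_smul, sub_zero] at h
    exact h.mono_left nhdsWithin_le_nhds
  obtain ⟨s, hs, hs0⟩ := ((hcont.eventually (isOpen_interior.mem_nhds hv)).and
    self_mem_nhdsWithin).exists
  have hs0 : 0 < s := hs0
  set w := v - s • (p₀ - x) with hw
  have hwB : w ∈ bouligand P x := interior_subset hs
  have hfr : ∃ᶠ t in nhdsWithin (0:ℝ) (Ioi 0), Metric.infDist (x + t • w) P / t < s * r := by
    apply Filter.frequently_lt_of_liminf_lt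
    · apply Filter.IsBoundedUnder.isCoboundedUnder_ge
      refine ⟨‖w‖, ?_⟩
      rw [Filter.eventually_map]
      filter_upwards [self_mem_nhdsWithin] with t ht
      have ht : 0 < t := ht
      rw [div_le_iff₀ ht]
      refine (Metric.infDist_le_dist_of_mem hx).trans ?_
      rw [dist_eq_norm, add_sub_cancel_left, norm_smul, Real.norm_of_nonneg ht.le, mul_comm]
    · have : Filter.liminf (fun t : ℝ => Metric.infDist (x + t • w) P / t)
        (nhdsWithin 0 (Set.Ioi 0)) = 0 := hwB
      rw [this]; positivity
  obtain ⟨t, ht, ht0⟩ := (hfr.and_eventually self_mem_nhdsWithin).exists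
  have ht0 : 0 < t := ht0
  rw [div_lt_iff₀ ht0, Metric.infDist_lt_iff ⟨x, hx⟩] at ht
  obtain ⟨p, hpP, hd⟩ := ht
  have hts : 0 < t * s := mul_pos ht0 hs0
  set q := p₀ + (t * s)⁻¹ • (x + t • w - p) with hq
  have hqi : q ∈ interior P := by
    apply hball
    rw [Metric.mem_ball, dist_eq_norm, hq, add_sub_cancel_left, norm_smul, norm_inv,
      Real.norm_of_nonneg hts.le, ← dist_eq_norm, inv_mul_lt_iff₀ hts]
    linarith
  refine ⟨t / (1 + t * s), by positivity, ?_⟩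
  have h1 : (1 + t * s) ≠ 0 := by positivity
  have := hP.combo_interior_self_mem_interior hqi hpP (a := t * s / (1 + t * s))
    (b := 1 / (1 + t * s)) (by positivity) (by positivity) (by field_simp; ring)
  convert this using 1
  rw [hq, hw]
  ext i
  simp only [Pi.add_apply, Pi.smul_apply, Pi.sub_apply, smul_eq_mul]
  field_simp
  ring

end main

section gaugeStep

variable {n m : ℕ} {A : Matrix (Fin n) (Fin n) ℝ} {B : Matrix (Fin n) (Fin m) ℝ}

lemma local_step {Q : Set (Fin n → ℝ)} (hQ : Convex ℝ Q) (h0 : (0 : Fin n → ℝ) ∈ interior Q)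
    {x : Fin n → ℝ} (hx : x ∈ Q) {u : Fin m → ℝ} {t₀ : ℝ} (ht₀ : 0 < t₀)
    (hin : x + t₀ • (A.mulVec x + B.mulVec u) ∈ interior Q) :
    ∃ c : ℝ, c < 1 ∧ ∃ N ∈ nhds x, ∀ x' ∈ N ∩ Q, ∃ T y, Steer A B ‖u‖ Q T x' y ∧ gauge Q y ≤ c := by
  obtain ⟨ψ, hψc, hψ0, hψ⟩ := exists_flow A B u
  set v := A.mulVec x + B.mulVec u with hv
  -- openness
  have ho : ∀ᶠ p : (Fin n → ℝ) × (Fin n → ℝ) in nhds (x, 0),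
      p.1 + t₀ • (v + p.2) ∈ interior Q := by
    have hc : Continuous fun p : (Fin n → ℝ) × (Fin n → ℝ) => p.1 + t₀ • (v + p.2) := by fun_prop
    apply hc.continuousAt.eventually
    apply isOpen_interior.mem_nhds
    simpa using hin
  obtain ⟨δ, hδ, hδb⟩ := Metric.eventually_nhds_iff.1 ho
  have hF : Continuous fun p : ℝ × (Fin n → ℝ) => A.mulVec (ψ p.1 p.2) + B.mulVec u :=
    ((continuous_mulVec' A).comp hψc).add continuous_const
  have hev : ∀ᶠ p : ℝ × (Fin n → ℝ) in nhds (0, x),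
      dist (A.mulVec (ψ p.1 p.2) + B.mulVec u) v < δ / 2 := by
    have h := hF.tendsto (0, x)
    simp only [hψ0] at h
    exact Metric.tendsto_nhds.1 h _ (by positivity)
  obtain ⟨η, hη, hηb⟩ := Metric.eventually_nhds_iff.1 hev
  set T := min (η / 2) t₀ with hT
  have hT0 : 0 < T := lt_min (by positivity) ht₀
  have hTt : T ≤ t₀ := min_le_right _ _
  have hTη : T < η := (min_le_left _ _).trans_lt (by linarith)
  have hstep : ∀ x' ∈ Q, dist x' x < min δ η → ∀ t, 0 < t → t ≤ T → ψ t x' ∈ interior Q := by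
    intro x' hx' hd t ht htT
    obtain ⟨hcF, hint⟩ := curve_integral (hψ x') t
    have hb : ‖∫ s in (0:ℝ)..t, (A.mulVec (ψ s x') + B.mulVec u - v)‖ ≤ δ / 2 * |t - 0| := by
      apply intervalIntegral.norm_integral_le_of_norm_le_const
      intro s hs
      rw [uIoc_of_le ht.le] at hs
      rw [← dist_eq_norm]
      refine (hηb (y := (s, x')) ?_).le
      rw [Prod.dist_eq]
      refine max_lt ?_ (hd.trans_le (min_le_right _ _))
      rw [Real.dist_eq, sub_zero, abs_of_pos hs.1]
      linarith [hs.2]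
    rw [sub_zero, abs_of_pos ht] at hb
    set e := t⁻¹ • ∫ s in (0:ℝ)..t, (A.mulVec (ψ s x') + B.mulVec u - v) with he
    have hen : ‖e‖ < δ := by
      rw [he, norm_smul, norm_inv, Real.norm_of_nonneg ht.le, inv_mul_lt_iff₀ ht]
      nlinarith
    have hpsi : ψ t x' = x' + t • (v + e) := by
      rw [hint, hψ0, he, smul_add, smul_smul, mul_inv_cancel₀ ht.ne', one_smul,
        intervalIntegral.integral_sub (hcF.intervalIntegrable _ _)
          (continuous_const.intervalIntegrable _ _), intervalIntegral.integral_const, sub_zero]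
      abel
    have hq : x' + t₀ • (v + e) ∈ interior Q := by
      refine hδb (y := (x', e)) ?_
      rw [Prod.dist_eq]
      refine max_lt (hd.trans_le (min_le_left _ _)) ?_
      simpa using hen
    have := hQ.combo_interior_self_mem_interior hq hx' (a := t / t₀) (b := 1 - t / t₀)
      (by positivity) (by
        have : t / t₀ ≤ 1 := by rw [div_le_one ht₀]; linarith
        linarith) (by ring)
    rw [hpsi]
    convert this using 1
    ext i
    simp only [Pi.add_apply, Pi.smul_apply, smul_eq_mul]
    field_simp
    ring
  have hQn : Q ∈ nhds 0 := mem_interior_iff_mem_nhds.1 h0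
  have hend : gauge Q (ψ T x) < 1 := by
    apply interior_subset_gauge_lt_one
    exact hstep x hx (by rw [dist_self]; exact lt_min hδ hη) T hT0 le_rfl
  obtain ⟨c, hc1, hc2⟩ := exists_between hend
  have hgc : Continuous fun x' => gauge Q (ψ T x') :=
    (continuous_gauge hQ hQn).comp (hψc.comp (by fun_prop : Continuous fun x' => (T, x')))
  have hN1 : ∀ᶠ x' in nhds x, gauge Q (ψ T x') < c := hgc.continuousAt.eventually (gt_mem_nhds hc1)
  have hN2 : ∀ᶠ x' in nhds x, dist x' x < min δ η :=
    Metric.ball_mem_nhds x (lt_min hδ hη)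
  refine ⟨c, hc2, _, hN1.and hN2, ?_⟩
  rintro x' ⟨⟨h1, h2⟩, hx'⟩
  refine ⟨T, ψ T x', ?_, h1.le⟩
  have := Steer.of_curve (S := Q) hT0.le (hψ x') (by
    intro t ht
    rcases ht.1.eq_or_lt with h | h
    · rw [← h, hψ0]; exact hx'
    · exact interior_subset (hstep x' hx' h2 t h ht.2))
  rwa [hψ0] at this

lemma unif_step {Q : Set (Fin n → ℝ)} (hQ : Convex ℝ Q) (hQc : IsCompact Q)
    (h0 : (0 : Fin n → ℝ) ∈ interior Q)
    (hin : ∀ x ∈ frontier Q, ∃ u : Fin m → ℝ, ∃ t > (0:ℝ),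
      x + t • (A.mulVec x + B.mulVec u) ∈ interior Q) :
    ∃ M c : ℝ, 0 ≤ M ∧ 0 ≤ c ∧ c < 1 ∧ ∀ x ∈ frontier Q, ∃ T y,
      Steer A B M Q T x y ∧ gauge Q y ≤ c := by
  have hfr : frontier Q ⊆ Q := hQc.isClosed.frontier_subset
  have hfc : IsCompact (frontier Q) := hQc.of_isClosed_subset isClosed_frontier hfr
  refine hfc.induction_on (p := fun s => ∃ M c : ℝ, 0 ≤ M ∧ 0 ≤ c ∧ c < 1 ∧ ∀ x ∈ s, ∃ T y,
      Steer A B M Q T x y ∧ gauge Q y ≤ c) ?_ ?_ ?_ ?_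
  · exact ⟨0, 0, le_rfl, le_rfl, one_pos, by simp⟩
  · rintro s t hst ⟨M, c, h1, h2, h3, h4⟩
    exact ⟨M, c, h1, h2, h3, fun x hx => h4 x (hst hx)⟩
  · rintro s t ⟨M, c, h1, h2, h3, h4⟩ ⟨M', c', h1', h2', h3', h4'⟩
    refine ⟨max M M', max c c', h1.trans (le_max_left _ _), h2.trans (le_max_left _ _),
      max_lt h3 h3', ?_⟩
    rintro x (hx | hx)
    · obtain ⟨T, y, hs, hg⟩ := h4 x hx
      exact ⟨T, y, hs.mono (le_max_left _ _) subset_rfl, hg.trans (le_max_left _ _)⟩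
    · obtain ⟨T, y, hs, hg⟩ := h4' x hx
      exact ⟨T, y, hs.mono (le_max_right _ _) subset_rfl, hg.trans (le_max_right _ _)⟩
  · intro x hx
    obtain ⟨u, t, ht, hu⟩ := hin x hx
    obtain ⟨c, hc, N, hN, h⟩ := local_step hQ h0 (hfr hx) ht hu
    refine ⟨N ∩ frontier Q, Filter.inter_mem (mem_nhdsWithin_of_mem_nhds hN) self_mem_nhdsWithin,
      ‖u‖, max c 0, norm_nonneg _, le_max_right _ _, max_lt hc one_pos, ?_⟩
    rintro x' ⟨h1, h2⟩
    obtain ⟨T, y, hs, hg⟩ := h x' ⟨h1, hfr h2⟩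
    exact ⟨T, y, hs, hg.trans (le_max_left _ _)⟩

lemma steer_origin (hAB : GenCtrb A B) {Q : Set (Fin n → ℝ)} (hQ : Convex ℝ Q)
    (hQc : IsCompact Q) (h0 : (0 : Fin n → ℝ) ∈ interior Q)
    (hin : ∀ x ∈ frontier Q, ∃ u : Fin m → ℝ, ∃ t > (0:ℝ),
      x + t • (A.mulVec x + B.mulVec u) ∈ interior Q) :
    ∃ M : ℝ, ∀ x ∈ interior Q, ∃ T, Steer A B M (interior Q) T x 0 := by
  obtain ⟨M, c, hM, hc0, hc1, hst⟩ := unif_step hQ hQc h0 hin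
  have hQn : Q ∈ nhds 0 := mem_interior_iff_mem_nhds.1 h0
  have hint : ∀ z, gauge Q z < 1 ↔ z ∈ interior Q := fun z => gauge_lt_one_iff_mem_interior hQ hQn
  have hle : ∀ z ∈ Q, gauge Q z ≤ 1 := fun z hz => gauge_le_one_of_mem hz
  -- iterated step
  have hit : ∀ k : ℕ, ∀ x ∈ interior Q, ∃ T y, Steer A B M (interior Q) T x y ∧
      gauge Q y ≤ c ^ k := by
    intro k x hx
    induction k with
    | zero =>
      exact ⟨0, x, Steer.refl hM hx, by simpa using ((hint x).2 hx).le⟩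
    | succ k ih =>
      obtain ⟨T, y, hs, hg⟩ := ih
      have hyI : y ∈ interior Q := by
        obtain ⟨hT, u, φ, -, -, -, h4, -, h6⟩ := hs
        rw [← h4]; exact h6 T ⟨hT, le_rfl⟩
      rcases (gauge_nonneg (s := Q) y).eq_or_lt with hz | hz
      · exact ⟨T, y, hs, by rw [← hz]; positivity⟩
      · set r := gauge Q y with hr
        have hr1 : r < 1 := (hint y).2 hyI
        have hfrn : r⁻¹ • y ∈ frontier Q := by
          rw [← gauge_eq_one_iff_mem_frontier hQ hQn, gauge_smul_of_nonneg (by positivity),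
            ← hr, smul_eq_mul, inv_mul_cancel₀ hz.ne']
        obtain ⟨T', z, hs', hg'⟩ := hst _ hfrn
        have := Steer.smul (S' := interior Q) r hs' (by
          intro w hw
          rw [← hint, gauge_smul_of_nonneg hz.le, smul_eq_mul]
          nlinarith [hle w hw])
        rw [smul_inv_smul₀ hz.ne', abs_of_pos hz] at this
        refine ⟨T + T', r • z, hs.trans (this.mono (by nlinarith) subset_rfl), ?_⟩
        rw [gauge_smul_of_nonneg hz.le, smul_eq_mul, pow_succ]
        exact mul_le_mul hg hg' (gauge_nonneg _) (by positivity)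
  obtain ⟨C, hC, hnc⟩ := nc_local hAB
  obtain ⟨ρ, hρ, hball⟩ := Metric.isOpen_iff.1 isOpen_interior 0 h0
  obtain ⟨D, hD, hDb⟩ := hQc.isBounded.exists_pos_norm_le
  have hnorm : ∀ z, ‖z‖ ≤ D * gauge Q z := by
    intro z
    have := le_gauge_of_subset_closedBall (s := Q) (r := D) (x := z)
      (absorbent_nhds_zero hQn) hD.le (fun w hw => by simpa using hDb w hw)
    rwa [div_le_iff₀ hD, mul_comm] at this
  obtain ⟨k, hk⟩ := exists_pow_lt_of_lt_one (show 0 < ρ / (C * D) by positivity) hc1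
  refine ⟨max M ρ, fun x hx => ?_⟩
  obtain ⟨T, y, hs, hg⟩ := hit k x hx
  have hy : C * ‖y‖ < ρ := by
    rw [lt_div_iff₀ (by positivity)] at hk
    have := hnorm y
    calc C * ‖y‖ ≤ C * (D * c ^ k) := by
          refine mul_le_mul_of_nonneg_left (this.trans ?_) hC.le
          exact mul_le_mul_of_nonneg_left hg hD.le
      _ < ρ := by linarith
  obtain ⟨T', hs'⟩ := hnc y
  refine ⟨T + T', (hs.mono (le_max_left _ _) subset_rfl).trans
    (hs'.mono (hy.le.trans (le_max_right _ _)) ?_)⟩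
  exact (Metric.closedBall_subset_ball hy).trans hball

/-- Version for a polytope with an equilibrium at `o`. -/
lemma steer_polytope (hAB : GenCtrb A B) {P : Set (Fin n → ℝ)} (hP : IsNPolytope P)
    {o : Fin n → ℝ} (ho : o ∈ interior P)
    (hin : ∀ x ∈ frontier P, ∃ u : Fin m → ℝ,
      A.mulVec (x - o) + B.mulVec u ∈ interior (bouligand P x)) :
    ∃ M : ℝ, ∀ x ∈ interior P, ∃ T, Steer A B M ((fun z => z + o) ⁻¹' interior P) T (x - o) 0 := by
  obtain ⟨⟨V, hV⟩, -⟩ := hP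
  have hPc : Convex ℝ P := by rw [hV]; exact convex_convexHull ℝ _
  have hPk : IsCompact P := by rw [hV]; exact V.finite_toSet.isCompact_convexHull ℝ
  let H : (Fin n → ℝ) ≃ₜ (Fin n → ℝ) := Homeomorph.addRight o
  have hH : ∀ z, H z = z + o := fun z => rfl
  have hI : H ⁻¹' interior P = interior (H ⁻¹' P) := H.preimage_interior P
  have hF : H ⁻¹' frontier P = frontier (H ⁻¹' P) := H.preimage_frontier P
  have hQ : Convex ℝ (H ⁻¹' P) := hPc.translate_preimage_left o
  have hQc : IsCompact (H ⁻¹' P) := H.isCompact_preimage.2 hPk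
  obtain ⟨M, hM⟩ := steer_origin (A := A) (B := B) hAB hQ hQc
    (by rw [← hI]; simpa [hH] using ho) (by
      intro x hx
      rw [← hF] at hx
      obtain ⟨u, hu⟩ := hin _ hx
      obtain ⟨t, ht, h⟩ := bouligand_interior hPc (hPk.isClosed.frontier_subset hx) ho hu
      refine ⟨u, t, ht, ?_⟩
      rw [← hI, mem_preimage, hH]
      rw [hH, add_sub_cancel_right] at h
      convert h using 1
      abel)
  refine ⟨M, fun x hx => ?_⟩
  rw [← hI] at hM
  exact hM (x - o) (by simpa [hH] using hx)

end gaugeStep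

/-- Case C, sufficiency. If `(A,B)` is controllable, there are `n`-dimensional
polytopes `X₁, X₂` with `X ⊂ X₁ ⊆ X'`, `X ⊂ X₂ ⊆ X'` satisfying the strict forward (resp.
backward) invariance conditions, and `X₁° ∩ X₂° ∩ 𝒪 ≠ ∅`, then the affine system is RIBC
w.r.t. `X` through `X'`. -/
theorem stmt10 {n m : ℕ} (A : Matrix (Fin n) (Fin n) ℝ) (B : Matrix (Fin n) (Fin m) ℝ)
    (a : Fin n → ℝ) (hB : B.rank = m) (X X' : Set (Fin n → ℝ))
    (hX : IsNPolytope X) (hX' : IsNPolytope X') (hXX' : X ⊂ X')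
    (hO1 : interior X ∩ equilSet A B a = ∅)
    (hO2 : (interior X' ∩ equilSet A B a).Nonempty)
    (hctrb : Controllable A B)
    (X₁ : Set (Fin n → ℝ)) (hX₁ : IsNPolytope X₁) (hXX₁ : X ⊂ X₁) (hX₁X' : X₁ ⊆ X')
    (hinv : ∀ x ∈ frontier X₁, ∃ u : Fin m → ℝ,
      A.mulVec x + B.mulVec u + a ∈ interior (bouligand X₁ x))
    (X₂ : Set (Fin n → ℝ)) (hX₂ : IsNPolytope X₂) (hXX₂ : X ⊂ X₂) (hX₂X' : X₂ ⊆ X')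
    (hbinv : ∀ x ∈ frontier X₂, ∃ u : Fin m → ℝ,
      -(A.mulVec x) - B.mulVec u - a ∈ interior (bouligand X₂ x))
    (hO12 : (interior X₁ ∩ interior X₂ ∩ equilSet A B a).Nonempty) :
    RIBC A B a X X' := by

  obtain ⟨o, ⟨ho1, ho2⟩, w, hw⟩ := hO12
  have hG := genCtrb_of_controllable hctrb
  obtain ⟨M₁, h1⟩ := steer_polytope hG hX₁ ho1 (by
    intro x hx
    obtain ⟨u, hu⟩ := hinv x hx
    refine ⟨u + w, ?_⟩
    convert hu using 1
    rw [Matrix.mulVec_sub, Matrix.mulVec_add, ← hw]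
    abel)
  obtain ⟨M₂, h2⟩ := steer_polytope hG.neg hX₂ ho2 (by
    intro x hx
    obtain ⟨u, hu⟩ := hbinv x hx
    refine ⟨u + w, ?_⟩
    convert hu using 1
    rw [Matrix.neg_mulVec, Matrix.neg_mulVec, Matrix.mulVec_sub, Matrix.mulVec_add, ← hw]
    abel)
  have hM : 0 ≤ max M₁ M₂ := by
    obtain ⟨T, h⟩ := h1 o ho1
    exact h.nonneg.trans (le_max_left _ _)
  refine ⟨max M₁ M₂ + ‖w‖ + 1, by positivity, ?_⟩
  intro x hx y hy
  obtain ⟨T₁, s1⟩ := h1 x (interior_mono hXX₁.1 hx)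
  obtain ⟨T₂, s2⟩ := h2 y (interior_mono hXX₂.1 hy)
  have s := (s1.mono (le_max_left M₁ M₂) (preimage_mono (interior_mono hX₁X'))).trans
    (s2.reverse.mono (le_max_right M₁ M₂) (preimage_mono (interior_mono hX₂X')))
  obtain ⟨hT, u, φ, k1, k2, k3, k4, k5, k6⟩ := s
  have e : (fun s => A.mulVec (φ s + o) + B.mulVec (u s - w) + a) =
      fun s => A.mulVec (φ s) + B.mulVec (u s) := by
    funext s
    rw [Matrix.mulVec_add, Matrix.mulVec_sub, ← hw]
    abel
  have x0 : φ 0 = x - o := by simpa using k3 0 ⟨le_rfl, hT⟩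
  refine ⟨T₁ + T₂, hT, fun t => u t - w, fun t => φ t + o, k1.sub_const w, ?_, by simp [x0],
    by simp [k4], ?_, ?_⟩
  · intro t ht
    rw [e]
    change φ t + o = φ 0 + o + _
    rw [x0, k3 t ht]
    abel
  · intro t ht
    have := norm_sub_le (u t) w
    have := k5 t ht
    linarith
  · intro t ht
    exact k6 t ht
end

section
/- Consider the linear control system ẋ = Ax + Bu on ℝⁿ with 𝒪 := {x ∈ ℝⁿ : Ax ∈ Im(B)}, and suppose 𝒪 + Im(B) = ℝⁿ. Then for every n-dimensional polytope X there exists an n-dimensional polytope X₁ with X ⊆ X₁ such that the invariance conditions of X₁ are solvable: for each x ∈ ∂X₁ there exists u ∈ ℝ^m with Ax + Bu ∈ T_{X₁}(x), the Bouligand tangent cone to X₁ at x. -/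
open Matrix Set Pointwise MeasureTheory

/-- If `𝒪 + Im B = ℝⁿ`, where `𝒪 = {x : A x ∈ Im B}` (a subspace for the
linear system `ẋ = Ax + Bu`), then every `n`-dimensional polytope `X` is contained in an
`n`-dimensional polytope `X₁` whose invariance conditions are solvable. -/
theorem stmt11 {n m : ℕ} (A : Matrix (Fin n) (Fin n) ℝ) (B : Matrix (Fin n) (Fin m) ℝ)
    (hB : B.rank = m)
    (hsum : Submodule.comap A.mulVecLin (LinearMap.range B.mulVecLin) ⊔
        LinearMap.range B.mulVecLin = ⊤) :
    ∀ X : Set (Fin n → ℝ), IsNPolytope X →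
      ∃ X₁ : Set (Fin n → ℝ), IsNPolytope X₁ ∧ X ⊆ X₁ ∧
        ∀ x ∈ frontier X₁, ∃ u : Fin m → ℝ,
          A.mulVec x + B.mulVec u ∈ bouligand X₁ x := by
  classical
  intro X hX
  obtain ⟨⟨V, rfl⟩, hint⟩ := hX
  have hdec : ∀ x : Fin n → ℝ, ∃ o b : Fin n → ℝ, (∃ c, A.mulVec o = B.mulVec c) ∧
      (∃ d, b = B.mulVec d) ∧ x = o + b := by
    intro x
    have hx : x ∈ Submodule.comap A.mulVecLin (LinearMap.range B.mulVecLin) ⊔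
        LinearMap.range B.mulVecLin := by rw [hsum]; trivial
    obtain ⟨o, ho, b, hb, rfl⟩ := Submodule.mem_sup.1 hx
    obtain ⟨c, hc⟩ := ho
    obtain ⟨d, hd⟩ := hb
    exact ⟨o, b, ⟨c, hc.symm⟩, ⟨d, hd.symm⟩, rfl⟩
  choose o b ho hb hob using hdec
  let W₀ : Finset (Fin n → ℝ) := V.image (fun v => (2 : ℝ) • o v) ∪ V.image (fun v => (2 : ℝ) • b v)
  let W : Finset (Fin n → ℝ) := W₀ ∪ W₀.image (fun v => -v)
  set X₁ : Set (Fin n → ℝ) := convexHull ℝ (W : Set (Fin n → ℝ)) with hX₁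
  have hconv : Convex ℝ X₁ := convex_convexHull ℝ _
  have hsub : convexHull ℝ (V : Set (Fin n → ℝ)) ⊆ X₁ := by
    refine convexHull_min ?_ hconv
    intro v hv
    have h1 : (2 : ℝ) • o v ∈ X₁ := subset_convexHull ℝ _ (by
      have : v ∈ V := hv
      simp only [W, W₀, Finset.coe_union, Finset.coe_image]
      exact Or.inl (Or.inl ⟨v, hv, rfl⟩))
    have h2 : (2 : ℝ) • b v ∈ X₁ := subset_convexHull ℝ _ (by
      simp only [W, W₀, Finset.coe_union, Finset.coe_image]
      exact Or.inl (Or.inr ⟨v, hv, rfl⟩))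
    have h3 := hconv h1 h2 (by norm_num : (0 : ℝ) ≤ 1 / 2) (by norm_num : (0 : ℝ) ≤ 1 / 2)
      (by norm_num)
    have h4 : v = (1 / 2 : ℝ) • (2 : ℝ) • o v + (1 / 2 : ℝ) • (2 : ℝ) • b v := by
      rw [smul_smul, smul_smul]; norm_num; exact hob v
    rw [h4]; exact h3
  have hneg : -X₁ = X₁ := by
    rw [hX₁, ← convexHull_neg]
    congr 1
    ext x
    simp only [W, Finset.coe_union, Finset.coe_image, Set.mem_neg, Set.mem_union, Set.mem_image]
    constructor
    · rintro (h | ⟨y, h, h'⟩)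
      · exact Or.inr ⟨-x, h, neg_neg x⟩
      · exact Or.inl (by rwa [← neg_injective h'])
    · rintro (h | ⟨y, h, h'⟩)
      · exact Or.inr ⟨x, h, rfl⟩
      · exact Or.inl (by rwa [← h', neg_neg])
  have hint₁ : (interior X₁).Nonempty := hint.mono (interior_mono hsub)
  have h0 : (0 : Fin n → ℝ) ∈ interior X₁ := by
    obtain ⟨y, hy⟩ := hint₁
    have hy' : -y ∈ interior X₁ := by
      have : interior X₁ = -interior X₁ := by
        conv_lhs => rw [← hneg]
        exact ((Homeomorph.neg (Fin n → ℝ)).preimage_interior X₁).symm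
      rw [this]; simpa using hy
    have := hconv.interior hy hy' (by norm_num : (0 : ℝ) ≤ 1 / 2) (by norm_num : (0 : ℝ) ≤ 1 / 2)
      (by norm_num)
    simpa using this
  refine ⟨X₁, ⟨⟨W, rfl⟩, hint₁⟩, hsub, ?_⟩
  let S : Set (Fin n → ℝ) := {x | ∃ u : Fin m → ℝ, ∃ ε > (0 : ℝ), ∀ t ∈ Set.Icc (0 : ℝ) ε,
    x + t • (A.mulVec x + B.mulVec u) ∈ X₁}
  have hSconv : Convex ℝ S := by
    rintro x ⟨u, ε, hε, hx⟩ y ⟨w, δ, hδ, hy⟩ p q hp hq hpq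
    refine ⟨p • u + q • w, min ε δ, lt_min hε hδ, fun t ht => ?_⟩
    have := hconv (hx t ⟨ht.1, ht.2.trans (min_le_left _ _)⟩)
      (hy t ⟨ht.1, ht.2.trans (min_le_right _ _)⟩) hp hq hpq
    convert this using 1
    simp only [Matrix.mulVec_add, Matrix.mulVec_smul]
    module
  have hSo : ∀ x ∈ X₁, (∃ c, A.mulVec x = B.mulVec c) → x ∈ S := by
    rintro x hx ⟨c, hc⟩
    refine ⟨-c, 1, one_pos, fun t _ => ?_⟩
    simpa [hc, Matrix.mulVec_neg] using hx
  have hSb : ∀ x ∈ X₁, (∃ d, x = B.mulVec d) → x ∈ S := by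
    rintro x hx ⟨d, hd⟩
    obtain ⟨e, he⟩ := hb (A.mulVec x)
    have hlim : Filter.Tendsto (fun s : ℝ => s • o (A.mulVec x)) (nhdsWithin 0 (Set.Ioi 0))
        (nhds 0) := by
      have : Continuous (fun s : ℝ => s • o (A.mulVec x)) := by fun_prop
      have h := this.tendsto 0
      rw [zero_smul] at h
      exact h.mono_left nhdsWithin_le_nhds
    have hev := hlim.eventually (mem_interior_iff_mem_nhds.1 h0)
    obtain ⟨ε, hε', hε⟩ := (hev.and self_mem_nhdsWithin).exists
    have hε : 0 < ε := hε
    refine ⟨-e - ε⁻¹ • d, ε, hε, fun t ht => ?_⟩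
    have hmem := hconv hx hε' (sub_nonneg.2 (div_le_one_of_le₀ ht.2 hε.le) : 0 ≤ 1 - t / ε)
      (div_nonneg ht.1 hε.le) (by ring)
    have hf : A.mulVec x + B.mulVec (-e - ε⁻¹ • d) = o (A.mulVec x) - ε⁻¹ • x := by
      rw [Matrix.mulVec_sub, Matrix.mulVec_neg, Matrix.mulVec_smul, ← he, ← hd]
      nth_rewrite 1 [hob (A.mulVec x)]
      abel
    rw [hf]
    convert hmem using 1
    rw [smul_smul, div_mul_cancel₀ _ hε.ne', div_eq_mul_inv]
    module
  have hWS : (W : Set (Fin n → ℝ)) ⊆ S := by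
    intro x hx
    have hx₁ : x ∈ X₁ := subset_convexHull ℝ _ hx
    simp only [W, W₀, Finset.coe_union, Finset.coe_image, Set.mem_union, Set.mem_image] at hx
    rcases hx with (⟨v, -, rfl⟩ | ⟨v, -, rfl⟩) | ⟨y, (⟨v, -, rfl⟩ | ⟨v, -, rfl⟩), rfl⟩
    · obtain ⟨c, hc⟩ := ho v
      exact hSo _ hx₁ ⟨(2 : ℝ) • c, by simp only [Matrix.mulVec_smul, hc]⟩
    · obtain ⟨c, hc⟩ := hb v
      exact hSb _ hx₁ ⟨(2 : ℝ) • c, by simp only [Matrix.mulVec_smul, ← hc]⟩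
    · obtain ⟨c, hc⟩ := ho v
      exact hSo _ hx₁ ⟨-((2 : ℝ) • c), by simp only [Matrix.mulVec_neg, Matrix.mulVec_smul, hc]⟩
    · obtain ⟨c, hc⟩ := hb v
      exact hSb _ hx₁ ⟨-((2 : ℝ) • c), by simp only [Matrix.mulVec_neg, Matrix.mulVec_smul, ← hc]⟩
  intro x hx
  have hclosed : IsClosed X₁ := W.finite_toSet.isClosed_convexHull ℝ
  have hxX : x ∈ X₁ := hclosed.frontier_subset hx
  obtain ⟨u, ε, hε, h⟩ := convexHull_min hWS hSconv hxX
  refine ⟨u, ?_⟩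
  have hev : (fun t : ℝ => Metric.infDist (x + t • (A.mulVec x + B.mulVec u)) X₁ / t)
      =ᶠ[nhdsWithin 0 (Set.Ioi 0)] fun _ => (0 : ℝ) := by
    filter_upwards [Ioo_mem_nhdsGT hε] with t ht
    rw [Metric.infDist_zero_of_mem (h t ⟨ht.1.le, ht.2.le⟩), zero_div]
  change Filter.liminf _ _ = _
  rw [Filter.liminf_congr hev]
  exact Filter.liminf_const 0
end

section
/- Consider the linear control system ẋ = Ax + Bu on ℝⁿ, a convex set C ⊆ ℝⁿ with 0 ∈ C, constants M > 0 and T > 0. Suppose x₁,…,x_l ∈ C are points such that for each i there exist T_i ∈ [0,T] and an admissible control u_i on [0,T_i] with ‖u_i(t)‖ ≤ M, φ(x_i,t,u_i) ∈ C for all t ∈ [0,T_i], and φ(x_i,T_i,u_i) = 0. Extend each control by zero: ū_i(t) := u_i(t) for t ∈ [0,T_i) and ū_i(t) := 0 for t ∈ [T_i,T]. Then for any convex combination x' = Σᵢ αᵢ xᵢ (αᵢ ≥ 0, Σᵢ αᵢ = 1), the control u'(t) := Σᵢ αᵢ ū_i(t) satisfies ‖u'(t)‖ ≤ M for all t ∈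 [0,T], φ(x',t,u') ∈ C for all t ∈ [0,T], and φ(x',T,u') = 0. -/
open Matrix Set Pointwise MeasureTheory

lemma aux_bound {n : ℕ} (ψ : ℝ → Fin n → ℝ) (t a K : ℝ) (ht : 0 ≤ t) (hK : 0 ≤ K)
    (hc : ContinuousOn ψ (Set.Icc 0 t))
    (h : ∀ s ∈ Set.Icc (0 : ℝ) t, ‖ψ s‖ ≤ a + K * ∫ r in (0 : ℝ)..s, ‖ψ r‖) :
    ∀ s ∈ Set.Icc (0 : ℝ) t, ‖ψ s‖ ≤ a + K * gronwallBound 0 K a s := by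
  set p : ℝ → Fin n → ℝ := Set.IccExtend ht ((Set.Icc 0 t).domRestrict ψ) with hp
  have hpc : Continuous p := (continuousOn_iff_continuous_domRestrict.1 hc).Icc_extend'
  have hpe : ∀ s ∈ Set.Icc (0 : ℝ) t, p s = ψ s := fun s hs => by
    rw [hp, Set.IccExtend_of_mem ht _ hs]; rfl
  have hint : ∀ s ∈ Set.Icc (0 : ℝ) t, ∫ r in (0 : ℝ)..s, ‖ψ r‖ = ∫ r in (0 : ℝ)..s, ‖p r‖ := by
    intro s hs
    apply intervalIntegral.integral_congr
    intro r hr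
    rw [Set.uIcc_of_le hs.1] at hr
    simp only [hpe r ⟨hr.1, hr.2.trans hs.2⟩]
  set f : ℝ → ℝ := fun s => ∫ r in (0 : ℝ)..s, ‖p r‖ with hf
  have hd : ∀ s, HasDerivAt f ‖p s‖ s := fun s =>
    hpc.norm.integral_hasStrictDerivAt 0 s |>.hasDerivAt
  have hfn : ∀ s ∈ Set.Icc (0 : ℝ) t, 0 ≤ f s := fun s hs =>
    intervalIntegral.integral_nonneg hs.1 (fun _ _ => norm_nonneg _)
  have key := norm_le_gronwallBound_of_norm_deriv_right_le (f := f) (f' := fun s => ‖p s‖)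
    (δ := 0) (K := K) (ε := a) (a := 0) (b := t)
    (fun s _ => (hd s).continuousAt.continuousWithinAt) (fun s _ => (hd s).hasDerivWithinAt)
    (by simp [hf]) (by
      intro s hs
      have hs' := Set.Ico_subset_Icc_self hs
      have := h s hs'
      rw [hint s hs'] at this
      rw [norm_norm, hpe s hs', Real.norm_of_nonneg (hfn s hs')]
      linarith)
  intro s hs
  have h1 := h s hs
  have h2 := key s hs
  rw [hint s hs] at h1
  rw [Real.norm_of_nonneg (hfn s hs), sub_zero] at h2
  have := mul_le_mul_of_nonneg_left h2 hK
  exact h1.trans (by linarith)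

lemma aux_mulVec {n m : ℕ} (A : Matrix (Fin n) (Fin m) ℝ) :
    ∃ K : ℝ, 0 ≤ K ∧ ∀ v, ‖A.mulVec v‖ ≤ K * ‖v‖ :=
  ⟨‖A.mulVecLin.toContinuousLinearMap‖, norm_nonneg _,
    fun v => A.mulVecLin.toContinuousLinearMap.le_opNorm v⟩

lemma aux_cont {n m : ℕ} (A : Matrix (Fin n) (Fin m) ℝ) : Continuous (fun v => A.mulVec v) :=
  A.mulVecLin.toContinuousLinearMap.continuous

lemma aux_bu {n m : ℕ} (B : Matrix (Fin n) (Fin m) ℝ) (u : ℝ → Fin m → ℝ) (M : ℝ)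
    (hu : Measurable u) {S : Set ℝ} (hS : MeasurableSet S) (hfin : volume S ≠ ⊤)
    (hb : ∀ t ∈ S, ‖u t‖ ≤ M) : IntegrableOn (fun s => B.mulVec (u s)) S := by
  obtain ⟨K, hK, hKb⟩ := aux_mulVec B
  refine Measure.integrableOn_of_bounded (M := K * M) hfin
    ((aux_cont B).measurable.comp hu).aestronglyMeasurable ?_
  filter_upwards [ae_restrict_mem hS] with s hs
  exact (hKb _).trans (mul_le_mul_of_nonneg_left (hb s hs) hK)

lemma aux_int {n m : ℕ} (A : Matrix (Fin n) (Fin n) ℝ) (B : Matrix (Fin n) (Fin m) ℝ)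
    (u : ℝ → Fin m → ℝ) (φ : ℝ → Fin n → ℝ) (T M : ℝ) (hT : 0 ≤ T) (hM : 0 < M)
    (hu : Measurable u) (hsol : IsSol A B 0 u φ T)
    (hb : ∀ t ∈ Set.Icc (0 : ℝ) T, ‖u t‖ ≤ M) :
    IntervalIntegrable (fun s => A.mulVec (φ s) + B.mulVec (u s) + 0) volume 0 T := by
  obtain ⟨K, hK, hKb⟩ := aux_mulVec A
  obtain ⟨L, hL, hLb⟩ := aux_mulVec B
  set g : ℝ → Fin n → ℝ := fun s => A.mulVec (φ s) + B.mulVec (u s) + 0 with hg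
  set G : Set ℝ := {t | t ∈ Set.Icc 0 T ∧ IntervalIntegrable g volume 0 t} with hG
  have hdown : ∀ t ∈ G, Set.Icc 0 t ⊆ G := by
    rintro t ⟨ht, hi⟩ s hs
    refine ⟨⟨hs.1, hs.2.trans ht.2⟩, hi.mono_set ?_⟩
    rw [Set.uIcc_of_le hs.1, Set.uIcc_of_le ht.1]
    exact Set.Icc_subset_Icc_right hs.2
  have hcont : ∀ t ∈ G, ContinuousOn φ (Set.Icc 0 t) := by
    rintro t ⟨ht, hi⟩
    have h1 : ContinuousOn (fun s => φ 0 + ∫ r in (0 : ℝ)..s, g r) (Set.Icc 0 t) := by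
      have := intervalIntegral.continuousOn_primitive_interval' hi Set.left_mem_uIcc
      rw [Set.uIcc_of_le ht.1] at this
      exact continuousOn_const.add this
    exact h1.congr (fun s hs => hsol s ⟨hs.1, hs.2.trans ht.2⟩)
  set a : ℝ := ‖φ 0‖ + L * M * T with ha
  have ha0 : 0 ≤ a := by positivity
  have hbd : ∀ t ∈ G, ‖φ t‖ ≤ a + K * gronwallBound 0 K a T := by
    intro t htG
    obtain ⟨ht, hi⟩ := htG
    have hc := hcont t ⟨ht, hi⟩
    have h1 := aux_bound φ t a K ht.1 hK hc (by
      intro s hs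
      have hsT : s ∈ Set.Icc 0 T := ⟨hs.1, hs.2.trans ht.2⟩
      have hni : IntervalIntegrable (fun r => ‖φ r‖) volume 0 s := by
        apply ContinuousOn.intervalIntegrable
        rw [Set.uIcc_of_le hs.1]
        exact (hc.mono (Set.Icc_subset_Icc_right hs.2)).norm
      have h2 : ‖∫ r in (0 : ℝ)..s, g r‖ ≤ ∫ r in (0 : ℝ)..s, (K * ‖φ r‖ + L * M) := by
        apply intervalIntegral.norm_integral_le_of_norm_le hs.1
        · refine Filter.Eventually.of_forall fun r hr => ?_
          have hu1 := hb r ⟨hr.1.le, hr.2.trans hsT.2⟩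
          calc ‖g r‖ ≤ ‖A.mulVec (φ r)‖ + ‖B.mulVec (u r)‖ := by
                simp only [hg, add_zero]; exact norm_add_le _ _
            _ ≤ K * ‖φ r‖ + L * M := add_le_add (hKb _)
                ((hLb _).trans (mul_le_mul_of_nonneg_left hu1 hL))
        · exact (hni.const_mul K).add intervalIntegrable_const
      rw [intervalIntegral.integral_add (hni.const_mul K) intervalIntegrable_const,
        intervalIntegral.integral_const_mul, intervalIntegral.integral_const] at h2
      have h3 : (s - 0) • (L * M) ≤ L * M * T := by
        rw [smul_eq_mul, sub_zero, mul_comm]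
        exact mul_le_mul_of_nonneg_left hsT.2 (by positivity)
      rw [hsol s hsT]
      exact (norm_add_le _ _).trans (by linarith))
    have h2 := h1 t ⟨ht.1, le_rfl⟩
    have h3 := gronwallBound_mono le_rfl ha0 hK ht.2 (δ := 0)
    have := mul_le_mul_of_nonneg_left h3 hK
    linarith
  have hGo : G.OrdConnected := ⟨fun s hs t ht r hr => hdown t ht ⟨hs.1.1.trans hr.1, hr.2⟩⟩
  have hGm : MeasurableSet G := hGo.measurableSet
  have hGc : ContinuousOn φ (G \ {T}) := by
    rintro t ⟨htG, htT⟩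
    by_cases hm : ∃ t' ∈ G, t < t'
    · obtain ⟨t', ht', hlt⟩ := hm
      refine ((hcont t' ht') t ⟨htG.1.1, hlt.le⟩).mono_of_mem_nhdsWithin ?_
      rw [mem_nhdsWithin]
      exact ⟨Set.Iio t', isOpen_Iio, hlt, fun r hr => ⟨hr.2.1.1.1, hr.1.le⟩⟩
    · push Not at hm
      exact ((hcont t htG) t ⟨htG.1.1, le_rfl⟩).mono
        (fun r hr => ⟨hr.1.1.1, hm r hr.1⟩)
  have hGm' : MeasurableSet (G \ {T}) := hGm.diff (measurableSet_singleton T)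
  have hi1 : IntegrableOn φ (G \ {T}) := by
    refine IntegrableOn.of_bound ?_
      (hGc.aestronglyMeasurable hGm') (a + K * gronwallBound 0 K a T) ?_
    · exact lt_of_le_of_lt (measure_mono fun r hr => hr.1.1)
        (measure_Icc_lt_top (a := (0 : ℝ)) (b := T))
    · filter_upwards [ae_restrict_mem hGm'] with s hs using hbd s hs.1
  have hi2 : IntegrableOn φ (Set.Icc 0 T \ G) := by
    have h : IntegrableOn (fun _ : ℝ => φ 0) (Set.Icc 0 T \ G) :=
      integrableOn_const (ne_top_of_le_ne_top (measure_Icc_lt_top (a := (0 : ℝ)) (b := T)).ne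
        (measure_mono Set.sdiff_subset))
    refine h.congr_fun (fun s hs => ?_) (measurableSet_Icc.diff hGm)
    have hbad : ¬ IntervalIntegrable g volume 0 s := fun h => hs.2 ⟨hs.1, h⟩
    have := hsol s hs.1
    rw [intervalIntegral.integral_undef hbad, add_zero] at this
    exact this.symm
  have hi3 : IntegrableOn φ {T} := integrableOn_singleton (hx := by rw [Real.volume_singleton]; exact ENNReal.zero_lt_top)
  have hφ : IntegrableOn φ (Set.Icc 0 T) := by
    refine ((hi1.union hi2).union hi3).mono_set (fun s hs => ?_)
    by_cases h1 : s ∈ G <;> by_cases h2 : s = T <;> simp [h1, h2, hs]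
  have hA : IntegrableOn (fun s => A.mulVec (φ s)) (Set.Icc 0 T) :=
    A.mulVecLin.toContinuousLinearMap.integrable_comp hφ
  have hBu := aux_bu B u M hu measurableSet_Icc measure_Icc_lt_top.ne hb
  have hall : IntegrableOn g (Set.Icc 0 T) := by
    simp only [hg, add_zero]
    exact hA.add hBu
  rw [intervalIntegrable_iff_integrableOn_Icc_of_le hT]
  exact hall

lemma aux_ext {n : ℕ} (g φ : ℝ → Fin n → ℝ) (τ T : ℝ) (hτ : τ ∈ Set.Icc 0 T)
    (hi : IntervalIntegrable g volume 0 τ)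
    (hs : ∀ t ∈ Set.Icc (0 : ℝ) τ, φ t = φ 0 + ∫ s in (0 : ℝ)..t, g s) (hend : φ τ = 0) :
    (∀ t ∈ Set.Icc (0 : ℝ) T,
      IntervalIntegrable (fun s => if s < τ then g s else 0) volume 0 t ∧
      (if t < τ then φ t else 0) = φ 0 + ∫ s in (0 : ℝ)..t, (if s < τ then g s else 0)) := by
  have hae : ∀ t ∈ Set.Icc (0 : ℝ) τ, ∀ᵐ s : ℝ, s ∈ Set.uIoc 0 t →
      g s = (if s < τ then g s else 0) := by
    intro t ht
    filter_upwards [Measure.ae_ne volume τ] with s hne hs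
    rw [Set.uIoc_of_le ht.1] at hs
    rw [if_pos (lt_of_le_of_ne (hs.2.trans ht.2) hne)]
  have hii : IntervalIntegrable (fun s => if s < τ then g s else 0) volume 0 τ :=
    hi.congr_ae ((ae_restrict_iff' measurableSet_uIoc).2 (hae τ ⟨hτ.1, le_rfl⟩))
  intro t ht
  rcases le_total t τ with h | h
  · refine ⟨hii.mono_set ?_, ?_⟩
    · rw [Set.uIcc_of_le ht.1, Set.uIcc_of_le hτ.1]
      exact Set.Icc_subset_Icc_right h
    · rw [← intervalIntegral.integral_congr_ae (hae t ⟨ht.1, h⟩), ← hs t ⟨ht.1, h⟩]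
      split_ifs with h'
      · rfl
      · rw [le_antisymm h (not_lt.1 h'), hend]
  · have hz : Set.EqOn (fun _ => (0 : Fin n → ℝ)) (fun s => if s < τ then g s else 0)
        (Set.uIcc τ t) := by
      intro s hs
      rw [Set.uIcc_of_le h] at hs
      simp [not_lt.2 hs.1]
    have hi0 : IntervalIntegrable (fun s => if s < τ then g s else 0) volume τ t :=
      (intervalIntegrable_const (c := (0 : Fin n → ℝ))).congr
        (fun s hs => hz (Set.uIoc_subset_uIcc hs))
    refine ⟨hii.trans hi0, ?_⟩
    rw [← intervalIntegral.integral_add_adjacent_intervals hii hi0,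
      ← intervalIntegral.integral_congr hz,
      ← intervalIntegral.integral_congr_ae (hae τ ⟨hτ.1, le_rfl⟩), intervalIntegral.integral_zero,
      add_zero, ← hs τ ⟨hτ.1, le_rfl⟩, hend, if_neg (not_lt.2 h)]

/-- convexity of steering-to-zero. If each `xᵢ ∈ C` can be steered to `0` in time
`Tᵢ ≤ T` through the convex set `C ∋ 0` with controls bounded by `M`, then, extending each
control by zero, any convex combination `x' = Σ αᵢ xᵢ` is steered to `0` at time `T` through `C`
by the control `u'(t) = Σ αᵢ ūᵢ(t)`, which is also bounded by `M`. -/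
theorem stmt13 {n m : ℕ} (A : Matrix (Fin n) (Fin n) ℝ) (B : Matrix (Fin n) (Fin m) ℝ)
    (hB : B.rank = m) (C : Set (Fin n → ℝ)) (hCconv : Convex ℝ C)
    (h0C : (0 : Fin n → ℝ) ∈ C) (M T : ℝ) (hM : 0 < M) (hT : 0 < T)
    (l : ℕ) (x : Fin l → Fin n → ℝ) (Ti : Fin l → ℝ)
    (u : Fin l → ℝ → Fin m → ℝ) (φ : Fin l → ℝ → Fin n → ℝ)
    (α : Fin l → ℝ) (hα : ∀ i, 0 ≤ α i) (hαsum : ∑ i, α i = 1)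
    (hxC : ∀ i, x i ∈ C)
    (hTi : ∀ i, Ti i ∈ Set.Icc (0 : ℝ) T)
    (hmeas : ∀ i, Measurable (u i))
    (hsol : ∀ i, IsSol A B 0 (u i) (φ i) (Ti i))
    (hinit : ∀ i, φ i 0 = x i)
    (hbound : ∀ i, ∀ t ∈ Set.Icc (0 : ℝ) (Ti i), ‖u i t‖ ≤ M)
    (hinC : ∀ i, ∀ t ∈ Set.Icc (0 : ℝ) (Ti i), φ i t ∈ C)
    (hend : ∀ i, φ i (Ti i) = 0) :
    (∀ t ∈ Set.Icc (0 : ℝ) T,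
        ‖∑ i, α i • (if t < Ti i then u i t else 0)‖ ≤ M) ∧
    ∃ ψ : ℝ → Fin n → ℝ,
      ψ 0 = ∑ i, α i • x i ∧
      IsSol A B 0 (fun t => ∑ i, α i • (if t < Ti i then u i t else 0)) ψ T ∧
      (∀ t ∈ Set.Icc (0 : ℝ) T, ψ t ∈ C) ∧ ψ T = 0 := by
  refine ⟨?_, fun t => ∑ i, α i • (if t < Ti i then φ i t else 0), ?_, ?_, ?_, ?_⟩
  · intro t ht
    calc ‖∑ i, α i • (if t < Ti i then u i t else 0)‖
        ≤ ∑ i, ‖α i • (if t < Ti i then u i t else 0)‖ := norm_sum_le _ _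
      _ ≤ ∑ i, α i * M := by
          refine Finset.sum_le_sum fun i _ => ?_
          rw [norm_smul, Real.norm_of_nonneg (hα i)]
          refine mul_le_mul_of_nonneg_left ?_ (hα i)
          split_ifs with h
          · exact hbound i t ⟨ht.1, h.le⟩
          · simpa using hM.le
      _ = M := by rw [← Finset.sum_mul, hαsum, one_mul]
  · refine Finset.sum_congr rfl fun i _ => ?_
    split_ifs with h
    · rw [hinit]
    · have h0 : Ti i = 0 := le_antisymm (not_lt.1 h) (hTi i).1
      have := hend i
      rw [h0, hinit] at this
      rw [this]
  · have hE := fun i => aux_ext (fun s => A.mulVec (φ i s) + B.mulVec (u i s) + 0) (φ i) (Ti i) T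
      (hTi i) (aux_int A B (u i) (φ i) (Ti i) M (hTi i).1 hM (hmeas i) (hsol i) (hbound i))
      (hsol i) (hend i)
    have h00 : ∀ i, (if 0 < Ti i then φ i 0 else 0) = φ i 0 := fun i => by
      have := (hE i 0 ⟨le_rfl, hT.le⟩).2
      rwa [intervalIntegral.integral_same, add_zero] at this
    intro t ht
    have hfun : ∀ s : ℝ, A.mulVec (∑ i, α i • (if s < Ti i then φ i s else 0)) +
        B.mulVec (∑ i, α i • (if s < Ti i then u i s else 0)) + 0 =
        ∑ i, α i • (if s < Ti i then A.mulVec (φ i s) + B.mulVec (u i s) + 0 else 0) := by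
      intro s
      rw [Matrix.mulVec_sum, Matrix.mulVec_sum, add_zero, ← Finset.sum_add_distrib]
      refine Finset.sum_congr rfl fun i _ => ?_
      rw [Matrix.mulVec_smul, Matrix.mulVec_smul]
      split_ifs <;> simp
    simp only [hfun, h00]
    have hsum := intervalIntegral.integral_finsetSum (s := Finset.univ)
      (fun i _ => ((hE i t ht).1.smul (α i)))
    simp only [Pi.smul_apply] at hsum
    rw [hsum, ← Finset.sum_add_distrib]
    refine Finset.sum_congr rfl fun i _ => ?_
    rw [(hE i t ht).2, intervalIntegral.integral_smul, smul_add]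
  · intro t ht
    refine hCconv.sum_mem (fun i _ => hα i) hαsum fun i _ => ?_
    split_ifs with h
    · exact hinC i t ⟨ht.1, h.le⟩
    · exact h0C
  · refine Finset.sum_eq_zero fun i _ => ?_
    rw [if_neg (not_lt.2 (hTi i).2), smul_zero]
end

section
/- Consider the two-dimensional linear system ẋ₁ = x₂ + u, ẋ₂ = u (i.e., ẋ = Ax + Bu with A = [[0,1],[0,0]] and B = (1,1)ᵀ), and the square X := {x ∈ ℝ² : −1 ≤ x₁ ≤ 1, −1 ≤ x₂ ≤ 1}. Suppose λ > 1 is such that there is an admissible control u on some interval [0,T] steering the system from 0 to the point x̄ := (0.9, −0.9) while the trajectory remains in the interior of λX := {λz : z ∈ X} for all t ∈ [0,T]. Then λ > 1.8. In particular, any λ > 1 for which all points of X° are mutually accessible through (λX)° must satisfy λ > 1.8. -/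
open Matrix Set Pointwise MeasureTheory

/-- The unit square `{x ∈ ℝ² : −1 ≤ x₁ ≤ 1, −1 ≤ x₂ ≤ 1}`. -/
def unitSquare : Set (Fin 2 → ℝ) :=
  {x | -1 ≤ x 0 ∧ x 0 ≤ 1 ∧ -1 ≤ x 1 ∧ x 1 ≤ 1}


lemma interior_lt (lam : ℝ) (hlam : 1 < lam) (x : Fin 2 → ℝ)
    (hx : x ∈ interior (lam • unitSquare)) : x 0 < lam := by
  have hsub : lam • unitSquare ⊆ (fun y : Fin 2 → ℝ => y 0) ⁻¹' Set.Iic lam := by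
    rintro _ ⟨z, hz, rfl⟩
    have h1 : z 0 ≤ 1 := hz.2.1
    simp only [Set.mem_preimage, Set.mem_Iic, Pi.smul_apply, smul_eq_mul]
    nlinarith
  have h := interior_mono hsub hx
  have ho : IsOpenMap (fun y : Fin 2 → ℝ => y 0) := isOpenMap_eval 0
  rw [← ho.preimage_interior_eq_interior_preimage (continuous_apply 0), interior_Iic] at h
  exact h

lemma key (lam : ℝ) (hlam : 1 < lam) (T : ℝ) (hT : 0 ≤ T) (u : ℝ → Fin 1 → ℝ)
    (φ : ℝ → Fin 2 → ℝ) (hsol : IsSol !![0, 1; 0, 0] !![1; 1] 0 u φ T)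
    (h0 : φ 0 = 0) (hTe : φ T = ![0.9, -0.9])
    (hin : ∀ t ∈ Set.Icc (0 : ℝ) T, φ t ∈ interior (lam • unitSquare)) : 1.8 < lam := by
  set g : ℝ → Fin 2 → ℝ := fun s =>
    (!![0, 1; 0, 0] : Matrix (Fin 2) (Fin 2) ℝ).mulVec (φ s)
      + (!![1; 1] : Matrix (Fin 2) (Fin 1) ℝ).mulVec (u s) + 0 with hg
  have hs : ∀ t ∈ Set.Icc (0 : ℝ) T, φ t = ∫ s in (0 : ℝ)..t, g s := by
    intro t ht
    have := hsol t ht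
    rw [h0, zero_add] at this
    exact this
  have hgi : IntervalIntegrable g volume 0 T := by
    by_contra hc
    have h := hs T ⟨hT, le_rfl⟩
    rw [intervalIntegral.integral_undef hc, hTe] at h
    have := congrFun h 0
    norm_num at this
  have hcont : ContinuousOn φ (Set.Icc 0 T) := by
    have h := intervalIntegral.continuousOn_primitive_interval' hgi
      (Set.left_mem_uIcc)
    rw [Set.uIcc_of_le hT] at h
    exact h.congr hs
  have hc1 : ContinuousOn (fun t => φ t 1) (Set.Icc 0 T) :=
    (continuous_apply 1).comp_continuousOn hcont
  have hφi : ∀ a ∈ Set.Icc 0 T, ∀ b ∈ Set.Icc 0 T,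
      IntervalIntegrable (fun t => φ t 1) volume a b := by
    intro a ha b hb
    exact (hc1.mono (Set.uIcc_subset_Icc ha hb)).intervalIntegrable
  have hm0 : (0 : ℝ) ∈ Set.Icc 0 T := ⟨le_rfl, hT⟩
  have hmT : T ∈ Set.Icc 0 T := ⟨hT, le_rfl⟩
  have hz : ∀ t ∈ Set.Icc (0 : ℝ) T, φ t 0 - φ t 1 = ∫ s in (0 : ℝ)..t, φ s 1 := by
    intro t ht
    have hgt : IntervalIntegrable g volume 0 t :=
      hgi.mono_set (by rw [Set.uIcc_of_le hT, Set.uIcc_of_le ht.1]; exact Set.Icc_subset_Icc_right ht.2)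
    let L : (Fin 2 → ℝ) →L[ℝ] ℝ :=
      ContinuousLinearMap.proj (R := ℝ) (φ := fun _ : Fin 2 => ℝ) 0 -
      ContinuousLinearMap.proj (R := ℝ) (φ := fun _ : Fin 2 => ℝ) 1
    have h := L.intervalIntegral_comp_comm hgt
    rw [← hs t ht] at h
    have hL : ∀ v, L v = v 0 - v 1 := fun v => rfl
    rw [hL] at h
    rw [← h]
    congr 1
    funext s
    rw [hL]
    simp [hg, Matrix.mulVec, dotProduct, Fin.sum_univ_two]
  have hK : IsCompact (Set.Icc 0 T ∩ (fun t => φ t 1) ⁻¹' {0}) :=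
    isCompact_Icc.of_isClosed_subset
      (hc1.preimage_isClosed_of_isClosed isClosed_Icc isClosed_singleton) Set.inter_subset_left
  obtain ⟨τ, ⟨hτ, hτ0⟩, hmax⟩ := hK.exists_isGreatest ⟨0, hm0, by simp [h0]⟩
  have hτ0 : φ τ 1 = 0 := hτ0
  have hT1 : φ T 1 = -0.9 := by rw [hTe]; rfl
  have hT0 : φ T 0 = 0.9 := by rw [hTe]; rfl
  have hneg : ∀ t ∈ Set.Icc τ T, φ t 1 ≤ 0 := by
    intro t ht
    by_contra hc
    push Not at hc
    have htt : 0 ≤ t := hτ.1.trans ht.1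
    have hiv := intermediate_value_Icc' ht.2 (hc1.mono (Set.Icc_subset_Icc_left htt))
    obtain ⟨r, hr, hr0⟩ := hiv (show (0 : ℝ) ∈ _ from ⟨by simp only [hT1]; norm_num, hc.le⟩)
    have hle := hmax ⟨⟨htt.trans hr.1, hr.2⟩, hr0⟩
    have : t = τ := le_antisymm (hr.1.trans hle) ht.1
    rw [this, hτ0] at hc
    exact lt_irrefl _ hc
  have hadd := intervalIntegral.integral_add_adjacent_intervals (hφi 0 hm0 τ hτ) (hφi τ hτ T hmT)
  have hnp : ∫ s in τ..T, φ s 1 ≤ 0 := by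
    have := intervalIntegral.integral_mono_on hτ.2 (hφi τ hτ T hmT)
      (intervalIntegrable_const (c := (0 : ℝ))) hneg
    simpa using this
  rw [← hz τ hτ, ← hz T hmT, hτ0, hT1, hT0] at hadd
  have := interior_lt lam hlam _ (hin τ hτ)
  norm_num at hadd ⊢
  linarith

lemma mem_interior_sq (x : Fin 2 → ℝ) (h0 : -1 < x 0) (h1 : x 0 < 1) (h2 : -1 < x 1)
    (h3 : x 1 < 1) : x ∈ interior unitSquare := by
  rw [mem_interior]
  refine ⟨{y | -1 < y 0} ∩ {y | y 0 < 1} ∩ {y | -1 < y 1} ∩ {y | y 1 < 1}, ?_, ?_, ?_⟩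
  · rintro y ⟨⟨⟨a, b⟩, c⟩, d⟩
    exact ⟨le_of_lt a, le_of_lt b, le_of_lt c, le_of_lt d⟩
  · refine ((IsOpen.inter ?_ ?_).inter ?_).inter ?_ <;>
      exact isOpen_lt (by fun_prop) (by fun_prop)
  · exact ⟨⟨⟨h0, h1⟩, h2⟩, h3⟩

/-- For `ẋ = Ax + Bu`, `A = [[0,1],[0,0]]`, `B = (1,1)ᵀ`, and the square `X`:
if `λ > 1` admits a trajectory from `0` to `x̄ = (0.9, −0.9)` staying in `(λX)°`, then
`λ > 1.8`; in particular, any `λ > 1` for which all points of `X°` are mutually accessible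
through `(λX)°` satisfies `λ > 1.8`. -/
theorem stmt14 (lam : ℝ) (hlam : 1 < lam) :
    ((∃ T ≥ (0 : ℝ), ∃ u : ℝ → Fin 1 → ℝ, ∃ φ : ℝ → Fin 2 → ℝ,
        Measurable u ∧ IsSol !![0, 1; 0, 0] !![1; 1] 0 u φ T ∧
        φ 0 = 0 ∧ φ T = ![0.9, -0.9] ∧
        (∀ t ∈ Set.Icc (0 : ℝ) T, φ t ∈ interior (lam • unitSquare))) →
      1.8 < lam) ∧
    ((∀ x ∈ interior unitSquare, ∀ y ∈ interior unitSquare,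
        ∃ T ≥ (0 : ℝ), ∃ u : ℝ → Fin 1 → ℝ, ∃ φ : ℝ → Fin 2 → ℝ,
          Measurable u ∧ IsSol !![0, 1; 0, 0] !![1; 1] 0 u φ T ∧
          φ 0 = x ∧ φ T = y ∧
          (∀ t ∈ Set.Icc (0 : ℝ) T, φ t ∈ interior (lam • unitSquare))) →
      1.8 < lam) := by
  constructor
  · rintro ⟨T, hT, u, φ, -, hsol, h0, h1, hin⟩
    exact key lam hlam T hT u φ hsol h0 h1 hin
  · intro H
    obtain ⟨T, hT, u, φ, -, hsol, h0, h1, hin⟩ := H 0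
      (mem_interior_sq _ (by simp) (by simp) (by simp) (by simp)) ![0.9, -0.9]
      (mem_interior_sq _ (by norm_num) (by norm_num) (by norm_num) (by norm_num))
    exact key lam hlam T hT u φ hsol h0 h1 hin
end

section
/- Consider the linear control system ẋ = Ax + Bu on ℝⁿ and an n-dimensional polytope X with 0 ∈ X°. If the system is in-block controllable (IBC) with respect to X, then: (i) (A,B) is controllable; (ii) the invariance conditions of X are solvable, i.e., for each x ∈ ∂X there exists u ∈ ℝ^m with Ax + Bu ∈ C(x), the tangent cone to X at x; and (iii) the backward invariance conditions of X are solvable, i.e., for each x ∈ ∂X there exists u ∈ ℝ^m with −Ax − Bu ∈ C(x). -/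
open Matrix Set Pointwise MeasureTheory

/-- In-block controllability of `ẋ = Ax + Bu` w.r.t. `X`: all states of `X°` are mutually
accessible through `X°` with uniformly bounded controls. -/
def IBC {n m : ℕ} (A : Matrix (Fin n) (Fin n) ℝ) (B : Matrix (Fin n) (Fin m) ℝ)
    (X : Set (Fin n → ℝ)) : Prop :=
  ∃ M > (0 : ℝ), ∀ x ∈ interior X, ∀ y ∈ interior X,
    ∃ T ≥ (0 : ℝ), ∃ u : ℝ → Fin m → ℝ, ∃ φ : ℝ → Fin n → ℝ,
      Measurable u ∧ IsSol A B 0 u φ T ∧ φ 0 = x ∧ φ T = y ∧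
      (∀ t ∈ Set.Icc (0 : ℝ) T, ‖u t‖ ≤ M) ∧
      (∀ t ∈ Set.Icc (0 : ℝ) T, φ t ∈ interior X)

lemma sol_integrable {n m : ℕ} {A : Matrix (Fin n) (Fin n) ℝ} {B : Matrix (Fin n) (Fin m) ℝ}
    {u : ℝ → Fin m → ℝ} {φ : ℝ → Fin n → ℝ} {T M R : ℝ} (hT : 0 ≤ T)
    (hu : Measurable u) (hs : IsSol A B 0 u φ T)
    (huM : ∀ t ∈ Set.Icc (0 : ℝ) T, ‖u t‖ ≤ M)
    (hφR : ∀ t ∈ Set.Icc (0 : ℝ) T, ‖φ t‖ ≤ R) :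
    IntervalIntegrable (fun s => A.mulVec (φ s) + B.mulVec (u s) + 0) volume 0 T := by
  set g : ℝ → Fin n → ℝ := fun s => A.mulVec (φ s) + B.mulVec (u s) + 0 with hg
  set S : Set ℝ := {t | t ∈ Icc 0 T ∧ IntervalIntegrable g volume 0 t} with hS
  have h0S : (0 : ℝ) ∈ S := ⟨⟨le_rfl, hT⟩, IntervalIntegrable.refl⟩
  have hbdd : BddAbove S := ⟨T, fun t ht => ht.1.2⟩
  set τ := sSup S with hτ
  have hτ0 : 0 ≤ τ := le_csSup hbdd h0S
  have hτT : τ ≤ T := csSup_le ⟨0, h0S⟩ fun t ht => ht.1.2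
  -- continuity below
  have hcont : ∀ t ∈ S, ContinuousOn φ (Icc 0 t) := by
    intro t ht
    have h1 : ContinuousOn (fun x => ∫ s in (0:ℝ)..x, g s) (Icc 0 t) := by
      have := intervalIntegral.continuousOn_primitive_interval (f := g) (μ := volume) (a := 0) (b := t)
        ((intervalIntegrable_iff').1 ht.2)
      rwa [uIcc_of_le ht.1.1] at this
    refine (continuousOn_const (c := φ 0)).add h1 |>.congr ?_
    intro x hx
    exact hs x ⟨hx.1, hx.2.trans ht.1.2⟩
  have hconst : ∀ t ∈ Ioc τ T, φ t = φ 0 := by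
    intro t ht
    have ht' : t ∈ Icc 0 T := ⟨hτ0.trans ht.1.le, ht.2⟩
    have : ¬ IntervalIntegrable g volume 0 t := fun h =>
      absurd (le_csSup hbdd (show t ∈ S from ⟨ht', h⟩)) (not_le.2 ht.1)
    rw [hs t ht', intervalIntegral.integral_undef this, add_zero]
  have hm1 : AEStronglyMeasurable φ (volume.restrict (Ico 0 τ)) := by
    have : AEStronglyMeasurable φ (volume.restrict (⋃ k : ℕ, Icc 0 (τ - 1 / ((k:ℝ) + 1)))) := by
      rw [aestronglyMeasurable_iUnion_iff]
      intro k
      obtain ⟨t, htS, ht⟩ := exists_lt_of_lt_csSup ⟨0, h0S⟩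
        (show τ - 1 / ((k:ℝ) + 1) < sSup S by
          have : 0 < 1 / ((k:ℝ) + 1) := by positivity
          linarith)
      exact ((hcont t htS).mono (Icc_subset_Icc_right ht.le)).aestronglyMeasurable measurableSet_Icc
    refine this.mono_set ?_
    intro x hx
    obtain ⟨k, hk⟩ := exists_nat_one_div_lt (sub_pos.2 hx.2)
    exact mem_iUnion.2 ⟨k, hx.1, by linarith⟩
  have hm2 : AEStronglyMeasurable φ (volume.restrict (Ioc τ T)) := by
    refine (aestronglyMeasurable_const (b := φ 0)).congr ?_
    filter_upwards [ae_restrict_mem measurableSet_Ioc] with t ht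
    exact (hconst t ht).symm
  have hm3 : AEStronglyMeasurable φ (volume.restrict ({τ} : Set ℝ)) := by
    rw [Measure.restrict_eq_zero.2 (by simp)]
    exact aestronglyMeasurable_zero_measure _
  have hm : AEStronglyMeasurable φ (volume.restrict (Ioc 0 T)) := by
    have := aestronglyMeasurable_union_iff.2 ⟨aestronglyMeasurable_union_iff.2 ⟨hm1, hm3⟩, hm2⟩
    refine this.mono_set ?_
    intro x hx
    rcases lt_trichotomy x τ with h | h | h
    · exact Or.inl (Or.inl ⟨hx.1.le, h⟩)
    · exact Or.inl (Or.inr h)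
    · exact Or.inr ⟨h, hx.2⟩
  rw [intervalIntegrable_iff_integrableOn_Ioc_of_le hT]
  have hcA : Continuous (fun x => A.mulVec x) := continuous_const.matrix_mulVec continuous_id
  have hcB : Continuous (fun x => B.mulVec x) := continuous_const.matrix_mulVec continuous_id
  have hgm : AEStronglyMeasurable g (volume.restrict (Ioc 0 T)) :=
    ((hcA.comp_aestronglyMeasurable hm).add
      (hcB.comp_aestronglyMeasurable hu.aestronglyMeasurable)).add aestronglyMeasurable_const
  let A' := LinearMap.toContinuousLinearMap A.mulVecLin
  let B' := LinearMap.toContinuousLinearMap B.mulVecLin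
  refine Integrable.of_bound hgm (‖A'‖ * R + ‖B'‖ * M) ?_
  filter_upwards [ae_restrict_mem measurableSet_Ioc] with t ht
  have ht' : t ∈ Icc 0 T := ⟨ht.1.le, ht.2⟩
  have h1 : ‖A.mulVec (φ t)‖ ≤ ‖A'‖ * R := (A'.le_opNorm (φ t)).trans (by gcongr; exact hφR t ht')
  have h2 : ‖B.mulVec (u t)‖ ≤ ‖B'‖ * M := (B'.le_opNorm (u t)).trans (by gcongr; exact huM t ht')
  simp only [hg, add_zero]
  exact (norm_add_le _ _).trans (add_le_add h1 h2)

lemma mem_bouligand_of_closure {n : ℕ} {X : Set (Fin n → ℝ)} (hc : Convex ℝ X)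
    {x v : Fin n → ℝ} (hx : x ∈ X)
    (hv : v ∈ closure {v : Fin n → ℝ | ∃ s : ℝ, 0 ≤ s ∧ ∃ z ∈ X, v = s • (z - x)}) :
    v ∈ bouligand X x := by
  refine Filter.Tendsto.liminf_eq ?_
  rw [Metric.tendsto_nhds]
  intro ε hε
  obtain ⟨w, ⟨s, hs, z, hz, rfl⟩, hw⟩ := Metric.mem_closure_iff.1 hv ε hε
  have h1 : Ioo (0:ℝ) (1 / (s + 1)) ∈ nhdsWithin (0:ℝ) (Ioi 0) :=
    Ioo_mem_nhdsGT (by positivity)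
  filter_upwards [h1] with t ht
  have hts : t * s ≤ 1 := by
    have := (lt_div_iff₀ (by positivity)).1 ht.2
    nlinarith [ht.1]
  have hmem : x + (t * s) • (z - x) ∈ X := by
    exact hc.add_smul_sub_mem hx hz ⟨mul_nonneg ht.1.le hs, hts⟩
  have h2 : Metric.infDist (x + t • v) X ≤ t * dist v (s • (z - x)) := by
    refine (Metric.infDist_le_dist_of_mem hmem).trans (le_of_eq ?_)
    rw [dist_add_left, mul_smul, dist_smul₀, Real.norm_of_nonneg ht.1.le]
  rw [Real.dist_eq, sub_zero, abs_of_nonneg (div_nonneg Metric.infDist_nonneg ht.1.le),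
    div_lt_iff₀ ht.1]
  nlinarith [ht.1]

lemma ibc_reverse {n m : ℕ} {A : Matrix (Fin n) (Fin n) ℝ} {B : Matrix (Fin n) (Fin m) ℝ}
    {X : Set (Fin n → ℝ)} {R : ℝ} (hR : ∀ x ∈ X, ‖x‖ ≤ R) (h : IBC A B X) :
    IBC (-A) (-B) X := by
  obtain ⟨M, hM, H⟩ := h
  refine ⟨M, hM, fun x hx y hy => ?_⟩
  obtain ⟨T, hT, u, φ, hu, hs, h0, h1, huM, hφ⟩ := H y hy x hx
  have hmem : ∀ t ∈ Icc (0:ℝ) T, T - t ∈ Icc (0:ℝ) T := fun t ht =>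
    ⟨by linarith [ht.2], by linarith [ht.1]⟩
  refine ⟨T, hT, fun t => u (T - t), fun t => φ (T - t), hu.comp (measurable_const.sub measurable_id),
    ?_, by simpa using h1, by simpa using h0, fun t ht => huM _ (hmem t ht),
    fun t ht => hφ _ (hmem t ht)⟩
  have hi := sol_integrable hT hu hs huM (fun t ht => hR _ (interior_subset (hφ t ht)))
  intro t ht
  have e1 := hs (T - t) (hmem t ht)
  have e2 := hs T ⟨hT, le_rfl⟩
  have hsub : ∀ a ∈ Icc (0:ℝ) T, ∀ b ∈ Icc (0:ℝ) T, uIcc a b ⊆ uIcc 0 T := by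
    intro a ha b hb
    rw [uIcc_of_le hT]
    exact (convex_Icc 0 T).ordConnected.uIcc_subset ha hb
  have e3 := intervalIntegral.integral_add_adjacent_intervals
    (hi.mono_set (hsub 0 ⟨le_rfl, hT⟩ (T - t) (hmem t ht)))
    (hi.mono_set (hsub (T - t) (hmem t ht) T ⟨hT, le_rfl⟩))
  have e4 := intervalIntegral.integral_comp_sub_left (a := 0) (b := t)
    (fun s => A.mulVec (φ s) + B.mulVec (u s) + 0) T
  have e5 : (∫ s in (0:ℝ)..t, ((-A).mulVec (φ (T - s)) + (-B).mulVec (u (T - s)) + 0))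
      = - ∫ s in (0:ℝ)..t, (A.mulVec (φ (T - s)) + B.mulVec (u (T - s)) + 0) := by
    rw [← intervalIntegral.integral_neg]
    congr 1
    ext s : 1
    simp only [Matrix.neg_mulVec, add_zero]
    abel
  show φ (T - t) = φ (T - 0) + _
  rw [e5, e4, sub_zero, e2, e1, ← e3]
  abel

lemma invariance {n m : ℕ} {A : Matrix (Fin n) (Fin n) ℝ} {B : Matrix (Fin n) (Fin m) ℝ}
    {X : Set (Fin n → ℝ)} {R : ℝ} (hR : ∀ x ∈ X, ‖x‖ ≤ R) (hcl : IsClosed X) (hc : Convex ℝ X)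
    (h0 : (0 : Fin n → ℝ) ∈ interior X) (h : IBC A B X) :
    ∀ x ∈ frontier X, ∃ u : Fin m → ℝ, A.mulVec x + B.mulVec u ∈ bouligand X x := by
  obtain ⟨M, hM, H⟩ := h
  intro x hx
  have hxX : x ∈ X := hcl.frontier_subset hx
  have hx0 : x ≠ 0 := by
    rintro rfl
    exact hx.2 h0
  have hxn : 0 < ‖x‖ := norm_pos_iff.2 hx0
  let A' := LinearMap.toContinuousLinearMap A.mulVecLin
  let B' := LinearMap.toContinuousLinearMap B.mulVecLin
  have hA' : ∀ z, A' z = A.mulVec z := fun z => rfl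
  have hB' : ∀ z, B' z = B.mulVec z := fun z => rfl
  set C0 : Set (Fin n → ℝ) := {v | ∃ s : ℝ, 0 ≤ s ∧ ∃ z ∈ X, v = s • (z - x)} with hC0
  by_contra hcon
  push Not at hcon
  set K : Set (Fin n → ℝ) := (fun u => A' x + B' u) '' Metric.closedBall 0 M with hK
  have hKc : IsCompact K := (isCompact_closedBall _ _).image (by fun_prop)
  have hKconv : Convex ℝ K := by
    have : K = (fun z => A' x + z) '' (B' '' Metric.closedBall 0 M) := by
      rw [hK, image_image]
    rw [this]
    exact ((convex_closedBall _ _).linear_image B'.toLinearMap).translate _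
  have hC0conv : Convex ℝ C0 := by
    rintro _ ⟨s, hs, z, hz, rfl⟩ _ ⟨s', hs', z', hz', rfl⟩ a b ha hb hab
    have ha' : 0 ≤ a * s := mul_nonneg ha hs
    have hb' : 0 ≤ b * s' := mul_nonneg hb hs'
    rcases (add_nonneg ha' hb').eq_or_lt with h | h
    · have h1 : a * s = 0 := by linarith
      have h2 : b * s' = 0 := by linarith
      refine ⟨0, le_rfl, x, hxX, ?_⟩
      rw [smul_smul, smul_smul, h1, h2]; simp
    · refine ⟨a * s + b * s', h.le, (a * s / (a * s + b * s')) • z + (b * s' / (a * s + b * s')) • z',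
        hc hz hz' (by positivity) (by positivity) (by field_simp), ?_⟩
      ext i
      simp only [Pi.add_apply, Pi.smul_apply, Pi.sub_apply, smul_eq_mul]
      field_simp
      ring
  have hdisj : Disjoint K (closure C0) := by
    rw [Set.disjoint_left]
    rintro _ ⟨u, hu, rfl⟩ hcl'
    exact hcon u (mem_bouligand_of_closure hc hxX hcl')
  obtain ⟨f, a, b, hfa, hab, hfb⟩ :=
    geometric_hahn_banach_compact_closed hKconv hKc hC0conv.closure isClosed_closure hdisj
  have hb0 : b < 0 := by
    have := hfb 0 (subset_closure ⟨0, le_rfl, x, hxX, by simp⟩)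
    simpa using this
  have hfX : ∀ z ∈ X, f x ≤ f z := by
    intro z hz
    by_contra hlt
    push Not at hlt
    have hpos : 0 < f x - f z := by linarith
    have := hfb ((-b / (f x - f z)) • (z - x))
      (subset_closure ⟨_, (div_pos (by linarith) hpos).le, z, hz, rfl⟩)
    rw [map_smul, map_sub, smul_eq_mul] at this
    have e : -b / (f x - f z) * (f z - f x) = b := by field_simp; ring
    linarith
  set c : ℝ := -b with hcdef
  have hcpos : 0 < c := by linarith
  have hfu : ∀ u : Fin m → ℝ, ‖u‖ ≤ M → f (A' x + B' u) ≤ -c := by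
    intro u hu
    have := hfa _ ⟨u, by simpa using hu, rfl⟩
    simp only at this
    linarith
  -- radius
  obtain ⟨r0, hr0, hr0'⟩ : ∃ r0 > 0, ∀ z, dist z x < r0 → f (A' z) - f (A' x) < c / 2 := by
    have hcont : Continuous fun z => f (A' z) := by fun_prop
    obtain ⟨r0, hr0, h⟩ := Metric.continuous_iff.1 hcont x (c / 2) (by linarith)
    exact ⟨r0, hr0, fun z hz => (le_abs_self _).trans_lt (h z hz)⟩
  set r : ℝ := min r0 ‖x‖ / 2 with hr
  have hrpos : 0 < r := by have := lt_min hr0 hxn; positivity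
  have hrr0 : r < r0 := by have := min_le_left r0 ‖x‖; have := lt_min hr0 hxn; linarith
  have hrx : r < ‖x‖ := by have := min_le_right r0 ‖x‖; have := lt_min hr0 hxn; linarith
  have hR0 : 0 ≤ R := (norm_nonneg x).trans (hR x hxX)
  set L : ℝ := ‖A'‖ * R + ‖B'‖ * M + 1 with hL
  have hLpos : 0 < L := by positivity
  set t0 : ℝ := r / (2 * L) with ht0
  have ht0pos : 0 < t0 := by positivity
  have hLt0 : L * t0 = r / 2 := by rw [ht0]; field_simp
  -- starting point
  obtain ⟨z, hzX, hz1, hz2⟩ : ∃ z ∈ interior X, dist z x < r / 2 ∧ f z - f x < c / 2 * t0 := by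
    have hxc : x ∈ closure (interior X) := by
      rw [hc.closure_interior_eq_closure_of_nonempty_interior ⟨0, h0⟩]
      exact subset_closure hxX
    obtain ⟨d, hd, hd'⟩ := Metric.continuous_iff.1 f.continuous x (c / 2 * t0) (by positivity)
    obtain ⟨z, hz, hzd⟩ := Metric.mem_closure_iff.1 hxc (min d (r / 2)) (lt_min hd (by linarith))
    rw [dist_comm] at hzd
    exact ⟨z, hz, hzd.trans_le (min_le_right _ _),
      (le_abs_self _).trans_lt (hd' z (hzd.trans_le (min_le_left _ _)))⟩
  obtain ⟨T, hT, u, φ, hu, hs, hφ0, hφT, huM, hφ⟩ := H z hzX 0 h0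
  have hφR : ∀ t ∈ Icc (0:ℝ) T, ‖φ t‖ ≤ R := fun t ht => hR _ (interior_subset (hφ t ht))
  have hi := sol_integrable hT hu hs huM hφR
  have hgL : ∀ t ∈ Icc (0:ℝ) T, ‖A.mulVec (φ t) + B.mulVec (u t) + 0‖ ≤ L := by
    intro t ht
    have h1 : ‖A.mulVec (φ t)‖ ≤ ‖A'‖ * R := (A'.le_opNorm (φ t)).trans (by gcongr; exact hφR t ht)
    have h2 : ‖B.mulVec (u t)‖ ≤ ‖B'‖ * M := (B'.le_opNorm (u t)).trans (by gcongr; exact huM t ht)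
    rw [add_zero]
    have := norm_add_le (A.mulVec (φ t)) (B.mulVec (u t))
    linarith
  have hspeed : ∀ t ∈ Icc (0:ℝ) T, dist (φ t) z ≤ L * t := by
    intro t ht
    rw [dist_eq_norm, hs t ht, hφ0, add_sub_cancel_left]
    have := intervalIntegral.norm_integral_le_of_norm_le_const (a := 0) (b := t) (C := L)
      (f := fun s => A.mulVec (φ s) + B.mulVec (u s) + 0) (fun s hs' => by
        rw [uIoc_of_le ht.1] at hs'
        exact hgL s ⟨hs'.1.le, hs'.2.trans ht.2⟩)
    rwa [sub_zero, abs_of_nonneg ht.1] at this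
  rcases le_or_gt t0 T with hcase | hcase
  · have ht0T : t0 ∈ Icc 0 T := ⟨ht0pos.le, hcase⟩
    have hi0 : IntervalIntegrable (fun s => A.mulVec (φ s) + B.mulVec (u s) + 0) volume 0 t0 := by
      refine hi.mono_set ?_
      rw [uIcc_of_le hT, uIcc_of_le ht0pos.le]
      exact Icc_subset_Icc_right hcase
    have e1 : f (φ t0) = f z + ∫ s in (0:ℝ)..t0, f (A.mulVec (φ s) + B.mulVec (u s) + 0) := by
      rw [hs t0 ht0T, map_add, hφ0, f.intervalIntegral_comp_comm hi0]
    have e2 : (∫ s in (0:ℝ)..t0, f (A.mulVec (φ s) + B.mulVec (u s) + 0))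
        ≤ ∫ s in (0:ℝ)..t0, (-(c / 2)) := by
      refine intervalIntegral.integral_mono_on ht0pos.le ?_ (by simp) ?_
      · exact ⟨f.integrable_comp hi0.1, f.integrable_comp hi0.2⟩
      · intro s hs'
        have hsT : s ∈ Icc 0 T := ⟨hs'.1, hs'.2.trans hcase⟩
        have hd : dist (φ s) x < r0 := by
          have h1 := hspeed s hsT
          have h2 : L * s ≤ L * t0 := by gcongr; exact hs'.2
          have h3 := dist_triangle (φ s) z x
          linarith
        have h1 := hr0' _ hd
        have h2 := hfu _ (huM s hsT)
        rw [map_add] at h2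
        rw [add_zero, map_add, ← hA', ← hB']
        linarith
    rw [intervalIntegral.integral_const, sub_zero, smul_eq_mul] at e2
    have := hfX _ (interior_subset (hφ t0 ht0T))
    nlinarith
  · have h1 := hspeed T ⟨hT, le_rfl⟩
    have h2 : L * T ≤ L * t0 := by gcongr
    have h3 := dist_triangle (φ T) z x
    rw [hφT, dist_zero_left x, ← hφT] at h3
    linarith

lemma controllable_of_ibc {n m : ℕ} {A : Matrix (Fin n) (Fin n) ℝ} {B : Matrix (Fin n) (Fin m) ℝ}
    {X : Set (Fin n → ℝ)} {R : ℝ} (hR : ∀ x ∈ X, ‖x‖ ≤ R)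
    (h0 : (0 : Fin n → ℝ) ∈ interior X) (h : IBC A B X) : Controllable A B := by
  by_contra hcon
  have hli : ¬ LinearIndependent ℝ (ctrbMat A B).row := fun hl => hcon (by
    have := hl.rank_matrix
    simpa [Controllable] using this)
  rw [← Matrix.vecMul_injective_iff] at hli
  obtain ⟨w, hw, hw0⟩ : ∃ w : Fin n → ℝ, w ᵥ* ctrbMat A B = 0 ∧ w ≠ 0 := by
    rw [Function.Injective] at hli
    push Not at hli
    obtain ⟨a, b, hab, hne⟩ := hli
    exact ⟨a - b, by rw [Matrix.sub_vecMul]; exact sub_eq_zero.2 hab, sub_ne_zero.2 hne⟩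
  have hk : ∀ k < n, w ᵥ* (A ^ k * B) = 0 := by
    intro k hk
    ext j
    exact congrFun hw (⟨k, hk⟩, j)
  have hall : ∀ k, w ᵥ* (A ^ k * B) = 0 := by
    intro k
    have hn : n ≠ 0 := by
      rintro rfl
      exact hw0 (Subsingleton.elim _ _)
    have hdeg : (Polynomial.X ^ k %ₘ A.charpoly).natDegree < n := by
      have := Polynomial.natDegree_modByMonic_lt (Polynomial.X ^ k) A.charpoly_monic (by
        intro h1
        have := A.charpoly_natDegree_eq_dim
        rw [h1] at this
        simp at this
        exact hn this.symm)
      rwa [A.charpoly_natDegree_eq_dim, Fintype.card_fin] at this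
    rw [A.pow_eq_aeval_mod_charpoly, Polynomial.aeval_eq_sum_range' hdeg, Matrix.sum_mul,
      Matrix.vecMul_sum]
    refine Finset.sum_eq_zero fun i hi => ?_
    rw [Matrix.smul_mul, Matrix.vecMul_smul, hk i (Finset.mem_range.1 hi), smul_zero]
  obtain ⟨M, hM, H⟩ := h
  obtain ⟨ε, hε, hεX⟩ : ∃ ε : ℝ, 0 < ε ∧ ε • w ∈ interior X := by
    have hc : ContinuousAt (fun ε : ℝ => ε • w) 0 := by fun_prop
    have h1 : ∀ᶠ ε : ℝ in nhds 0, ε • w ∈ interior X :=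
      hc.eventually (by simpa using isOpen_interior.mem_nhds h0)
    obtain ⟨d, hd, h2⟩ := Metric.eventually_nhds_iff.1 h1
    exact ⟨d / 2, by linarith, h2 (by rw [Real.dist_eq, sub_zero, abs_of_pos] <;> linarith)⟩
  obtain ⟨T, hT, u, φ, hu, hs, hφ0, hφT, huM, hφ⟩ := H 0 h0 _ hεX
  have hφR : ∀ t ∈ Icc (0:ℝ) T, ‖φ t‖ ≤ R := fun t ht => hR _ (interior_subset (hφ t ht))
  have hi := sol_integrable hT hu hs huM hφR
  let A' := LinearMap.toContinuousLinearMap A.mulVecLin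
  have hA' : ∀ z, A' z = A.mulVec z := fun z => rfl
  let q : ℕ → (Fin n → ℝ) →L[ℝ] ℝ := fun k =>
    LinearMap.toContinuousLinearMap ((dotProductBilin ℝ ℝ w).comp (A ^ k).mulVecLin)
  have hq : ∀ k z, q k z = w ⬝ᵥ ((A ^ k).mulVec z) := fun k z => rfl
  have hR0 : 0 ≤ R := (norm_nonneg _).trans (hR 0 (interior_subset h0))
  have hqb : ∀ k z, ‖q k z‖ ≤ ‖q 0‖ * (‖A'‖ ^ k * ‖z‖) := by
    intro k
    induction k with
    | zero => intro z; simpa using (q 0).le_opNorm z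
    | succ k ih =>
      intro z
      have e : q (k+1) z = q k (A' z) := by
        rw [hq, hq, hA', pow_succ, Matrix.mulVec_mulVec]
      rw [e]
      refine (ih _).trans ?_
      rw [pow_succ, mul_assoc]
      gcongr
      exact A'.le_opNorm z
  have hqint : ∀ k, ∀ t ∈ Icc (0:ℝ) T, q k (φ t) = ∫ s in (0:ℝ)..t, q (k+1) (φ s) := by
    intro k t ht
    have hi0 : IntervalIntegrable (fun s => A.mulVec (φ s) + B.mulVec (u s) + 0) volume 0 t := by
      refine hi.mono_set ?_
      rw [uIcc_of_le hT, uIcc_of_le ht.1]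
      exact Icc_subset_Icc_right ht.2
    rw [hs t ht, hφ0, zero_add, ← (q k).intervalIntegral_comp_comm hi0]
    congr 1
    ext s
    rw [add_zero, map_add, hq, hq, hq, Matrix.mulVec_mulVec, Matrix.mulVec_mulVec, ← pow_succ,
      Matrix.dotProduct_mulVec w (A ^ k * B), hall, zero_dotProduct, add_zero]
  have hmain : ∀ j k, ∀ t ∈ Icc (0:ℝ) T,
      ‖q k (φ t)‖ ≤ ‖q 0‖ * R * ‖A'‖ ^ (k + j) * (t ^ j / (j.factorial : ℝ)) := by
    intro j
    induction j with
    | zero =>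
      intro k t ht
      refine (hqb k _).trans ?_
      have := hφR t ht
      simp only [add_zero, pow_zero, Nat.factorial_zero, Nat.cast_one, div_one, mul_one]
      calc ‖q 0‖ * (‖A'‖ ^ k * ‖φ t‖) ≤ ‖q 0‖ * (‖A'‖ ^ k * R) := by gcongr
        _ = _ := by ring
    | succ j ih =>
      intro k t ht
      rw [hqint k t ht]
      refine (intervalIntegral.norm_integral_le_of_norm_le (g := fun s =>
        ‖q 0‖ * R * ‖A'‖ ^ (k + 1 + j) * (s ^ j / (j.factorial : ℝ))) ht.1 ?_ ?_).trans ?_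
      · refine Filter.Eventually.of_forall fun s hs' => ?_
        exact ih (k+1) s ⟨hs'.1.le, hs'.2.trans ht.2⟩
      · exact Continuous.intervalIntegrable (by fun_prop) _ _
      · rw [intervalIntegral.integral_const_mul, intervalIntegral.integral_div, integral_pow]
        apply le_of_eq
        rw [Nat.factorial_succ, show k + 1 + j = k + (j + 1) by ring]
        push_cast
        have : (j.factorial : ℝ) ≠ 0 := by positivity
        have : (j : ℝ) + 1 ≠ 0 := by positivity
        field_simp
        simp
  have hlim : Filter.Tendsto (fun j : ℕ => ‖q 0‖ * R * ((‖A'‖ * T) ^ j / (j.factorial : ℝ)))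
      Filter.atTop (nhds 0) := by
    have := (FloorSemiring.tendsto_pow_div_factorial_atTop (‖A'‖ * T)).const_mul (‖q 0‖ * R)
    simpa using this
  have hz : ‖q 0 (φ T)‖ ≤ 0 := by
    refine ge_of_tendsto' hlim fun j => (hmain j 0 T ⟨hT, le_rfl⟩).trans (le_of_eq ?_)
    rw [mul_pow, zero_add]; ring
  have hz' : q 0 (φ T) = 0 := norm_le_zero_iff.1 hz
  rw [hq, hφT, pow_zero, Matrix.one_mulVec, dotProduct_smul, smul_eq_mul] at hz'
  rcases mul_eq_zero.1 hz' with h | h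
  · exact hε.ne' h
  · exact hw0 (dotProduct_self_eq_zero.1 h)

/-- necessity part of the IBC theorem. If the linear system is IBC w.r.t. the
`n`-dimensional polytope `X` with `0 ∈ X°`, then (i) `(A,B)` is controllable, (ii) the
invariance conditions of `X` are solvable, and (iii) the backward invariance conditions of `X`
are solvable (tangent cones being the Bouligand tangent cones of `X`). -/
theorem stmt15 {n m : ℕ} (A : Matrix (Fin n) (Fin n) ℝ) (B : Matrix (Fin n) (Fin m) ℝ)
    (hB : B.rank = m) (X : Set (Fin n → ℝ)) (hX : IsNPolytope X)
    (h0 : (0 : Fin n → ℝ) ∈ interior X)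
    (hIBC : IBC A B X) :
    Controllable A B ∧
    (∀ x ∈ frontier X, ∃ u : Fin m → ℝ, A.mulVec x + B.mulVec u ∈ bouligand X x) ∧
    (∀ x ∈ frontier X, ∃ u : Fin m → ℝ, -(A.mulVec x) - B.mulVec u ∈ bouligand X x) := by
  obtain ⟨⟨V, hV⟩, -⟩ := hX
  have hc : Convex ℝ X := hV ▸ convex_convexHull ℝ _
  have hcomp : IsCompact X := hV ▸ V.finite_toSet.isCompact_convexHull ℝ
  obtain ⟨R, hR⟩ := hcomp.isBounded.exists_norm_le
  refine ⟨controllable_of_ibc hR h0 hIBC, invariance hR hcomp.isClosed hc h0 hIBC, ?_⟩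
  intro x hx
  obtain ⟨u, hu⟩ := invariance hR hcomp.isClosed hc h0 (ibc_reverse hR hIBC) x hx
  refine ⟨u, ?_⟩
  rwa [Matrix.neg_mulVec, Matrix.neg_mulVec, ← sub_eq_add_neg] at hu
end

section
/- Consider the affine control system ẋ = Ax + Bu + a on ℝⁿ and an n-dimensional polytope X = co{v₁,…,v_p}. If for each vertex vᵢ of X there exists uᵢ ∈ ℝ^m with Avᵢ + Buᵢ + a ∈ C(vᵢ), the tangent cone to X at vᵢ, then for every point x ∈ X there exists u ∈ ℝ^m with Ax + Bu + a ∈ C(x); i.e., solvability of the invariance conditions at the vertices of X implies their solvability at all points of X. -/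
open Matrix Set Pointwise MeasureTheory

/-- The distance to a nonempty convex set is a convex function. -/
lemma infDist_comb {n : ℕ} {X : Set (Fin n → ℝ)} (hX : Convex ℝ X) (hne : X.Nonempty)
    (p q : Fin n → ℝ) {b c : ℝ} (hb : 0 ≤ b) (hc : 0 ≤ c) (hbc : b + c = 1) :
    Metric.infDist (b • p + c • q) X ≤ b * Metric.infDist p X + c * Metric.infDist q X := by
  refine le_of_forall_pos_le_add fun ε hε => ?_
  obtain ⟨y, hy, hy2⟩ := (Metric.infDist_lt_iff hne).1 (lt_add_of_pos_right (Metric.infDist p X) hε)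
  obtain ⟨z, hz, hz2⟩ := (Metric.infDist_lt_iff hne).1 (lt_add_of_pos_right (Metric.infDist q X) hε)
  have h1 := Metric.infDist_le_dist_of_mem (x := b • p + c • q) (hX hy hz hb hc hbc)
  have h2 : dist (b • p + c • q) (b • y + c • z) ≤ b * dist p y + c * dist q z := by
    refine (dist_add_add_le _ _ _ _).trans ?_
    rw [dist_smul₀, dist_smul₀, Real.norm_of_nonneg hb, Real.norm_of_nonneg hc]
  have h3 : b * dist p y ≤ b * (Metric.infDist p X + ε) := by gcongr
  have h4 : c * dist q z ≤ c * (Metric.infDist q X + ε) := by gcongr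
  have h5 : b * ε + c * ε = ε := by rw [← add_mul, hbc, one_mul]
  linarith

lemma bouligand_tendsto {n : ℕ} {X : Set (Fin n → ℝ)} (hX : Convex ℝ X)
    {x w : Fin n → ℝ} (hx : x ∈ X) (hw : w ∈ bouligand X x) :
    Filter.Tendsto (fun t : ℝ => Metric.infDist (x + t • w) X / t)
      (nhdsWithin 0 (Set.Ioi 0)) (nhds 0) := by
  have hw' : Filter.liminf (fun t : ℝ => Metric.infDist (x + t • w) X / t)
        (nhdsWithin 0 (Set.Ioi 0)) = 0 := hw
  have hpos : ∀ᶠ t : ℝ in nhdsWithin 0 (Set.Ioi 0), 0 < t := self_mem_nhdsWithin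
  have hbd : ∀ᶠ t : ℝ in nhdsWithin 0 (Set.Ioi 0),
      Metric.infDist (x + t • w) X / t ≤ ‖w‖ := by
    filter_upwards [hpos] with t ht
    rw [div_le_iff₀ ht]
    refine (Metric.infDist_le_dist_of_mem hx).trans ?_
    rw [dist_eq_norm, add_sub_cancel_left, norm_smul, Real.norm_of_nonneg ht.le, mul_comm]
  rw [Metric.tendsto_nhds]
  intro ε hε
  have hcob : Filter.IsCoboundedUnder (· ≥ ·) (nhdsWithin (0 : ℝ) (Set.Ioi 0))
      (fun t : ℝ => Metric.infDist (x + t • w) X / t) :=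
    Filter.IsBoundedUnder.isCoboundedUnder_ge ⟨‖w‖, hbd⟩
  have hfr := Filter.frequently_lt_of_liminf_lt hcob (hw'.trans_lt hε)
  obtain ⟨s, hs, hs0⟩ := (hfr.and_eventually hpos).exists
  filter_upwards [hpos, nhdsWithin_le_nhds (Iio_mem_nhds hs0)] with t ht hts
  have hts : t < s := hts
  have hnn : 0 ≤ Metric.infDist (x + t • w) X / t := div_nonneg Metric.infDist_nonneg ht.le
  rw [Real.dist_eq, sub_zero, abs_of_nonneg hnn]
  refine lt_of_le_of_lt ?_ hs
  have hle : t / s ≤ 1 := (div_le_one hs0).2 hts.le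
  have h := infDist_comb hX ⟨x, hx⟩ x (x + s • w) (sub_nonneg.2 hle)
    (div_nonneg ht.le hs0.le) (by ring)
  have he : (1 - t / s) • x + (t / s) • (x + s • w) = x + t • w := by
    rw [smul_add, smul_smul, div_mul_cancel₀ _ hs0.ne', sub_smul, one_smul]
    abel
  rw [he, Metric.infDist_zero_of_mem hx, mul_zero, zero_add] at h
  rw [div_le_iff₀ ht]
  refine h.trans (le_of_eq ?_)
  ring

/-- for an affine system on an `n`-dimensional polytope `X = co{v₁,…,v_p}`,
solvability of the invariance conditions at the vertices of `X` (its extreme points) implies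
their solvability at every point of `X` (tangent cones being the Bouligand tangent cones). -/
theorem stmt16 {n m : ℕ} (A : Matrix (Fin n) (Fin n) ℝ) (B : Matrix (Fin n) (Fin m) ℝ)
    (a : Fin n → ℝ) (hB : B.rank = m)
    (V : Finset (Fin n → ℝ)) (X : Set (Fin n → ℝ))
    (hXV : X = convexHull ℝ (V : Set (Fin n → ℝ))) (hXint : (interior X).Nonempty)
    (hvert : ∀ v ∈ X.extremePoints ℝ, ∃ u : Fin m → ℝ,
      A.mulVec v + B.mulVec u + a ∈ bouligand X v) :
    ∀ x ∈ X, ∃ u : Fin m → ℝ, A.mulVec x + B.mulVec u + a ∈ bouligand X x := by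
  have hXc : Convex ℝ X := hXV ▸ convex_convexHull ℝ _
  have hXk : IsCompact X := hXV ▸ V.finite_toSet.isCompact_convexHull ℝ
  have hsub : X.extremePoints ℝ ⊆ (V : Set (Fin n → ℝ)) := by
    rw [hXV]; exact extremePoints_convexHull_subset
  have hfin : (X.extremePoints ℝ).Finite := V.finite_toSet.subset hsub
  have hKM : convexHull ℝ (X.extremePoints ℝ) = X := by
    have h := closure_convexHull_extremePoints hXk hXc
    rwa [(hfin.isClosed_convexHull ℝ).closure_eq] at h
  have key : X ⊆ {x | x ∈ X ∧ ∃ u : Fin m → ℝ,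
      Filter.Tendsto (fun t : ℝ =>
        Metric.infDist (x + t • (A.mulVec x + B.mulVec u + a)) X / t)
        (nhdsWithin 0 (Set.Ioi 0)) (nhds 0)} := by
    nth_rewrite 1 [← hKM]
    refine convexHull_min ?_ ?_
    · intro v hv
      obtain ⟨u, hu⟩ := hvert v hv
      exact ⟨hv.1, u, bouligand_tendsto hXc hv.1 hu⟩
    · rintro x ⟨hx, u, hu⟩ y ⟨hy, w, hw⟩ b c hb hc hbc
      refine ⟨hXc hx hy hb hc hbc, b • u + c • w, ?_⟩
      have hlim := (hu.const_mul b).add (hw.const_mul c)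
      rw [mul_zero, mul_zero, add_zero] at hlim
      have hpos : ∀ᶠ t : ℝ in nhdsWithin 0 (Set.Ioi 0), 0 < t := self_mem_nhdsWithin
      refine tendsto_of_tendsto_of_tendsto_of_le_of_le' tendsto_const_nhds hlim ?_ ?_
      · filter_upwards [hpos] with t ht
        exact div_nonneg Metric.infDist_nonneg ht.le
      · filter_upwards [hpos] with t ht
        have h := infDist_comb hXc ⟨x, hx⟩ (x + t • (A.mulVec x + B.mulVec u + a))
          (y + t • (A.mulVec y + B.mulVec w + a)) hb hc hbc
        have ha : a = b • a + c • a := by rw [← add_smul, hbc, one_smul]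
        have he : b • x + c • y + t • (A.mulVec (b • x + c • y) + B.mulVec (b • u + c • w) + a)
            = b • (x + t • (A.mulVec x + B.mulVec u + a))
              + c • (y + t • (A.mulVec y + B.mulVec w + a)) := by
          nth_rewrite 1 [ha]
          simp only [Matrix.mulVec_add, Matrix.mulVec_smul]
          module
        rw [he, ← mul_div_assoc, ← mul_div_assoc, ← add_div]
        gcongr
  intro x hx
  obtain ⟨-, u, hu⟩ := key hx
  exact ⟨u, hu.liminf_eq⟩
end
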